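/- arXiv:2405.04004 — 3 statements merged into one kernel-verified Lean document; each statement's English description precedes it below -/
import Mathlib

section
/- Let ℓ ≥ 2 be an integer, k_1,…,k_ℓ positive integers with k = k_1+⋯+k_ℓ, and p_1,…,p_ℓ ≥ 0 reals with p_1+⋯+p_ℓ = 1. Define reals a_1,…,a_{ℓ−1} by the polynomial identity (1 − z) ∏_{i=2}^{ℓ−1} (1 − p_i z) = 1 − Σ_{j=1}^{ℓ−1} a_j z^j. Then the polynomials F_{ℓ,n}(w) = Σ_m P_{ℓ,n}(m) w^m satisfy: F_{ℓ,n}(w) = 1 for 0 ≤ n < k, and for all n ≥ k, F_{ℓ,n}(w) = Σ_{j=1}^{ℓ−1} a_j F_{ℓ,n−j}(w) + (w−1) (∏_{i=1}^{ℓ} p_i^{k_i}) F_{ℓ,n−k}(w). -/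
/-- States are `Fin ℓ`, with the element of value `i` (0-based) playing the role of the
state `i+1` of the informal statement.  `OccursAt ℓ n k s j0` says that an occurrence of
the pattern `(k 0, …, k (ℓ-1))` starts at position `j0` in the sequence `s`:
there are `0 ≤ j0 < j1 < ⋯ < jℓ ≤ n` with `j_{i+1} - j_i ≥ k i`, all letters in the
`i`-th block equal to `i`, and either `j0 = 0` or the letter before `j0` differs from
the first state. -/
def OccursAt (ℓ n : ℕ) (k : Fin ℓ → ℕ) (s : Fin n → Fin ℓ) (j0 : ℕ) : Prop :=
  ∃ j : ℕ → ℕ, j 0 = j0 ∧ j ℓ ≤ n ∧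
    (∀ i : Fin ℓ, j i.val + k i ≤ j (i.val + 1)) ∧
    (∀ i : Fin ℓ, ∀ t : ℕ, ∀ ht : t < n,
      j i.val ≤ t → t < j (i.val + 1) → (s ⟨t, ht⟩ : ℕ) = i.val) ∧
    (j0 = 0 ∨ ∃ h : j0 - 1 < n, (s ⟨j0 - 1, h⟩ : ℕ) ≠ 0)

/-- The pattern count `X(s)`: the number of positions at which an occurrence of the
pattern `(k 0, …, k (ℓ-1))` starts. -/
noncomputable def patCount (ℓ n : ℕ) (k : Fin ℓ → ℕ) (s : Fin n → Fin ℓ) : ℕ :=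
  {j0 : ℕ | OccursAt ℓ n k s j0}.ncard

/-- `s` ends with the pattern `(k 0, …, k (ℓ-1))`: it has a suffix
`0^{a_0} 1^{a_1} ⋯ (ℓ-1)^{a_{ℓ-1}}` with `a_i ≥ k i`. -/
def EndsWith (ℓ n : ℕ) (k : Fin ℓ → ℕ) (s : Fin n → Fin ℓ) : Prop :=
  ∃ j : ℕ → ℕ, j ℓ = n ∧
    (∀ i : Fin ℓ, j i.val + k i ≤ j (i.val + 1)) ∧
    (∀ i : Fin ℓ, ∀ t : ℕ, ∀ ht : t < n,
      j i.val ≤ t → t < j (i.val + 1) → (s ⟨t, ht⟩ : ℕ) = i.val)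

/-- The weight of a sequence `s`: the product of the probabilities of its letters. -/
def wt (ℓ n : ℕ) (p : Fin ℓ → ℝ) (s : Fin n → Fin ℓ) : ℝ := ∏ t, p (s t)

/-- `F_{ℓ,n}(w) = Σ_{m≥0} P_{ℓ,n}(m) w^m ∈ ℝ[w]`, where `P_{ℓ,n}(m)` is the total weight
of the sequences of length `n` with pattern count `m`; equivalently
`F_{ℓ,n}(w) = Σ_s weight(s) · w^{X(s)}`. -/
noncomputable def Fpoly (ℓ n : ℕ) (k : Fin ℓ → ℕ) (p : Fin ℓ → ℝ) : Polynomial ℝ :=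
  ∑ s : Fin n → Fin ℓ, Polynomial.C (wt ℓ n p s) * Polynomial.X ^ patCount ℓ n k s

/-- The letters of `s` in `[j i, j (i + 1))` are all `i`, and this interval has length at least
`K i`, for every `i < m`. -/
def IsBlocks (K : ℕ → ℕ) (m : ℕ) (s j : ℕ → ℕ) : Prop :=
  (∀ i < m, j i + K i ≤ j (i + 1)) ∧ ∀ i < m, ∀ t, j i ≤ t → t < j (i + 1) → s t = i

/-- `OccursAt` for the length-`n` prefix of an infinite sequence. -/
def StartsAt (K : ℕ → ℕ) (m n : ℕ) (s : ℕ → ℕ) (j₀ : ℕ) : Prop :=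
  ∃ j : ℕ → ℕ, j 0 = j₀ ∧ j m ≤ n ∧ IsBlocks K m s j ∧ (j₀ = 0 ∨ s (j₀ - 1) ≠ 0)

/-- `patCount` for the length-`n` prefix of an infinite sequence. -/
noncomputable def startCount (K : ℕ → ℕ) (m n : ℕ) (s : ℕ → ℕ) : ℕ :=
  {j₀ | StartsAt K m n s j₀}.ncard

/-- The length-`n` prefix of `s` ends with blocks of the letters `0, …, m - 1`. -/
def BlocksEndAt (K : ℕ → ℕ) (m n : ℕ) (s : ℕ → ℕ) : Prop :=
  ∃ j : ℕ → ℕ, j m = n ∧ IsBlocks K m s j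

/-- The length-`n` prefix of `s` ends with blocks of the letters `0, …, m`, the last of which has
length exactly `K m`. -/
def CompletesAt (K : ℕ → ℕ) (m n : ℕ) (s : ℕ → ℕ) : Prop :=
  ∃ e, e + K m = n ∧ BlocksEndAt K m e s ∧ ∀ t, e ≤ t → t < n → s t = m

theorem IsBlocks.mono {K : ℕ → ℕ} {m : ℕ} {s j : ℕ → ℕ} (h : IsBlocks K m s j) {a b : ℕ}
    (hab : a ≤ b) (hb : b ≤ m) : j a ≤ j b := by
  induction b, hab using Nat.le_induction with
  | base => exact le_rfl
  | succ b hab ih =>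
    have := h.1 b (by omega)
    have := ih (by omega)
    omega

theorem IsBlocks.congr {K : ℕ → ℕ} {m n : ℕ} {s s' j : ℕ → ℕ} (h : IsBlocks K m s j)
    (hn : j m ≤ n) (hs : ∀ t < n, s t = s' t) : IsBlocks K m s' j := by
  refine ⟨h.1, fun i hi t h1 h2 => ?_⟩
  have := h.mono (a := i + 1) (b := m) (by omega) le_rfl
  rw [← hs t (by omega)]
  exact h.2 i hi t h1 h2

theorem IsBlocks.le {K : ℕ → ℕ} {m m' : ℕ} {s j : ℕ → ℕ} (h : IsBlocks K m s j)
    (hm : m' ≤ m) : IsBlocks K m' s j :=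
  ⟨fun i hi => h.1 i (by omega), fun i hi => h.2 i (by omega)⟩

theorem IsBlocks.of_eq {K : ℕ → ℕ} {m : ℕ} {s j j' : ℕ → ℕ} (h : IsBlocks K m s j)
    (hj : ∀ i ≤ m, j' i = j i) : IsBlocks K m s j' := by
  refine ⟨fun i hi => ?_, fun i hi t => ?_⟩
  · rw [hj i (by omega), hj (i + 1) (by omega)]
    exact h.1 i hi
  · rw [hj i (by omega), hj (i + 1) (by omega)]
    exact h.2 i hi t

theorem IsBlocks.snoc {K : ℕ → ℕ} {m n : ℕ} {s j : ℕ → ℕ} (h : IsBlocks K m s j)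
    (hn : j m + K m ≤ n) (hs : ∀ t, j m ≤ t → t < n → s t = m) :
    IsBlocks K (m + 1) s (Function.update j (m + 1) n) := by
  have hj : ∀ i ≤ m, Function.update j (m + 1) n i = j i := fun i hi => by
    rw [Function.update_of_ne (by omega)]
  have h' := h.of_eq hj
  have e1 := hj m le_rfl
  refine ⟨fun i hi => ?_, fun i hi t => ?_⟩
  · rcases Nat.lt_succ_iff_lt_or_eq.1 hi with hi | rfl
    · exact h'.1 i hi
    · rw [e1, Function.update_self]
      exact hn
  · rcases Nat.lt_succ_iff_lt_or_eq.1 hi with hi | rfl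
    · exact h'.2 i hi t
    · rw [e1, Function.update_self]
      exact hs t

theorem StartsAt.congr {K : ℕ → ℕ} {m n : ℕ} {s s' : ℕ → ℕ} {j₀ : ℕ}
    (h : StartsAt K m n s j₀) (hs : ∀ t < n, s t = s' t) : StartsAt K m n s' j₀ := by
  obtain ⟨j, h0, hn, hb, hst⟩ := h
  refine ⟨j, h0, hn, hb.congr hn hs, ?_⟩
  have := hb.mono (Nat.zero_le m) le_rfl
  rcases Nat.eq_zero_or_pos j₀ with h | h
  · exact Or.inl h
  · rw [← hs (j₀ - 1) (by omega)]
    exact hst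

theorem startCount_congr {K : ℕ → ℕ} {m n : ℕ} {s s' : ℕ → ℕ} (hs : ∀ t < n, s t = s' t) :
    startCount K m n s = startCount K m n s' := by
  unfold startCount
  congr 1
  ext j₀
  exact ⟨fun h => h.congr hs, fun h => h.congr fun t ht => (hs t ht).symm⟩

theorem blocksEndAt_congr {K : ℕ → ℕ} {m n : ℕ} {s s' : ℕ → ℕ} (hs : ∀ t < n, s t = s' t) :
    BlocksEndAt K m n s ↔ BlocksEndAt K m n s' :=
  ⟨fun ⟨j, h1, h2⟩ => ⟨j, h1, h2.congr h1.le hs⟩,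
    fun ⟨j, h1, h2⟩ => ⟨j, h1, h2.congr h1.le fun t ht => (hs t ht).symm⟩⟩

theorem BlocksEndAt.pos {K : ℕ → ℕ} {m n : ℕ} {s : ℕ → ℕ} (h : BlocksEndAt K (m + 1) n s)
    (hK : 0 < K m) : 0 < n := by
  obtain ⟨j, h1, h2⟩ := h
  have := h2.1 m (by omega)
  omega

theorem BlocksEndAt.last {K : ℕ → ℕ} {m n : ℕ} {s : ℕ → ℕ} (h : BlocksEndAt K (m + 1) n s)
    (hK : 0 < K m) : s (n - 1) = m := by
  obtain ⟨j, h1, h2⟩ := h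
  have := h2.1 m (by omega)
  exact h2.2 m (by omega) _ (by omega) (by omega)

theorem StartsAt.sum_le {K : ℕ → ℕ} {m n : ℕ} {s : ℕ → ℕ} {j₀ : ℕ}
    (h : StartsAt K m n s j₀) : ∑ i ∈ Finset.range m, K i ≤ n := by
  obtain ⟨j, h0, hn, hb, hst⟩ := h
  have : ∀ a ≤ m, ∑ i ∈ Finset.range a, K i ≤ j a := by
    intro a ha
    induction a with
    | zero => simp
    | succ a ih =>
      rw [Finset.sum_range_succ]
      have := ih (by omega)
      have := hb.1 a (by omega)
      omega
  exact (this m le_rfl).trans hn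

theorem StartsAt.succ {K : ℕ → ℕ} {m n : ℕ} {s : ℕ → ℕ} {j₀ : ℕ}
    (h : StartsAt K m n s j₀) : StartsAt K m (n + 1) s j₀ := by
  obtain ⟨j, h0, hn, hb, hst⟩ := h
  exact ⟨j, h0, by omega, hb, hst⟩

theorem finite_startsAt (K : ℕ → ℕ) (m n : ℕ) (s : ℕ → ℕ) :
    {j₀ | StartsAt K m n s j₀}.Finite := by
  refine (Set.finite_Iic n).subset ?_
  rintro j₀ ⟨j, h0, hn, hb, hst⟩
  have := hb.mono (Nat.zero_le m) le_rfl
  simp only [Set.mem_Iic]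
  omega

/-- A block occurrence has no letter `0` after its first block. -/
theorem IsBlocks.ne_zero {K : ℕ → ℕ} {m : ℕ} {s j : ℕ → ℕ} (h : IsBlocks K (m + 1) s j) {t : ℕ}
    (h1 : j 1 ≤ t) (h2 : t < j (m + 1)) : s t ≠ 0 := by
  induction m with
  | zero => exact absurd h1 (not_le.2 h2)
  | succ m ih =>
    by_cases ht : t < j (m + 1)
    · exact ih (h.le (by omega)) ht
    · rw [h.2 (m + 1) (by omega) t (by omega) h2]
      omega

/-- Of two occurrences in a word, the first one is already complete before the last letter. -/
theorem StartsAt.of_lt {K : ℕ → ℕ} {r n : ℕ} {s : ℕ → ℕ} {a b : ℕ} (hK : 0 < K 0)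
    (ha : StartsAt K (r + 1) (n + 1) s a) (hb : StartsAt K (r + 1) (n + 1) s b) (hab : a < b) :
    StartsAt K (r + 1) n s a := by
  obtain ⟨j, h0, hn, hj, hst⟩ := ha
  obtain ⟨j', h0', hn', hj', hst'⟩ := hb
  refine ⟨j, h0, ?_, hj, hst⟩
  have e1 := hj'.1 0 (by omega)
  have e2 := hj'.2 0 (by omega) b (by omega) (by omega)
  have e3 := hj'.mono (a := 1) (b := r + 1) (by omega) le_rfl
  rw [zero_add] at e1
  have e4 : j 1 < b := by
    by_contra hcon
    have := hj.2 0 (by omega) (b - 1) (by omega) (by rw [zero_add]; omega)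
    omega
  by_contra hcon
  exact hj.ne_zero (t := b) (by omega) (by omega) e2

theorem IsBlocks.extend_left {K : ℕ → ℕ} {m : ℕ} {s j : ℕ → ℕ} (h : IsBlocks K (m + 1) s j) :
    ∃ j' : ℕ → ℕ, IsBlocks K (m + 1) s j' ∧ j' (m + 1) = j (m + 1) ∧
      (j' 0 = 0 ∨ s (j' 0 - 1) ≠ 0) := by
  generalize hd : j 0 = d
  induction d generalizing j with
  | zero => exact ⟨j, h, rfl, Or.inl hd⟩
  | succ d ih =>
    by_cases hs : s d = 0
    · have h' : IsBlocks K (m + 1) s (Function.update j 0 d) := by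
        refine ⟨fun i hi => ?_, fun i hi t h1 h2 => ?_⟩
        · rw [Function.update_of_ne (by omega : i + 1 ≠ 0)]
          have := h.1 i hi
          rcases Nat.eq_zero_or_pos i with rfl | hi0
          · rw [Function.update_self]; omega
          · rw [Function.update_of_ne (by omega)]; exact this
        · rw [Function.update_of_ne (by omega : i + 1 ≠ 0)] at h2
          have := h.2 i hi t
          rcases Nat.eq_zero_or_pos i with rfl | hi0
          · rw [Function.update_self] at h1
            by_cases htd : t = d
            · rw [htd, hs]
            · exact this (by omega) h2
          · rw [Function.update_of_ne (by omega)] at h1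
            exact this h1 h2
      obtain ⟨j', h1, h2, h3⟩ := ih h' (Function.update_self ..)
      exact ⟨j', h1, by rw [h2, Function.update_of_ne (by omega)], h3⟩
    · exact ⟨j, h, rfl, Or.inr (by rw [hd]; exact hs)⟩

theorem IsBlocks.unique {K : ℕ → ℕ} {m : ℕ} {s j j' : ℕ → ℕ} (hK : ∀ i ≤ m, 0 < K i)
    (h : IsBlocks K (m + 1) s j) (h' : IsBlocks K (m + 1) s j') (h0 : j 0 = j' 0) :
    ∀ i ≤ m, j i = j' i := by
  intro i hi
  induction i with
  | zero => exact h0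
  | succ i ih =>
    have e := ih (by omega)
    have k1 := hK (i + 1) hi
    have a1 := h.1 i (by omega)
    have a2 := h'.1 i (by omega)
    have b1 := h.1 (i + 1) (by omega)
    have b2 := h'.1 (i + 1) (by omega)
    rcases lt_trichotomy (j (i + 1)) (j' (i + 1)) with hlt | heq | hlt
    · have c1 := h.2 (i + 1) (by omega) (j (i + 1)) le_rfl (by omega)
      have c2 := h'.2 i (by omega) (j (i + 1)) (by omega) hlt
      omega
    · exact heq
    · have c1 := h'.2 (i + 1) (by omega) (j' (i + 1)) le_rfl (by omega)
      have c2 := h.2 i (by omega) (j' (i + 1)) (by omega) hlt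
      omega

open Classical in
theorem startCount_succ {K : ℕ → ℕ} {r n : ℕ} {s : ℕ → ℕ} (hr : 0 < r)
    (hK : ∀ i ≤ r, 0 < K i) :
    startCount K (r + 1) (n + 1) s =
      startCount K (r + 1) n s + if CompletesAt K r (n + 1) s then 1 else 0 := by
  unfold startCount
  split_ifs with hc
  · obtain ⟨e, he, ⟨j, hje, hj⟩, hs⟩ := hc
    obtain ⟨r, rfl⟩ : ∃ q, r = q + 1 := ⟨r - 1, by omega⟩
    obtain ⟨j', hj', hje', hst⟩ := hj.extend_left
    have hb := hj'.snoc (n := n + 1) (by omega) (fun t h1 h2 => hs t (by omega) h2)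
    set j'' := Function.update j' (r + 1 + 1) (n + 1) with hj''
    have z0 : j'' 0 = j' 0 := Function.update_of_ne (by omega) ..
    have z1 : j'' (r + 1) = e := by
      rw [hj'', Function.update_of_ne (by omega), hje', hje]
    have hnew : StartsAt K (r + 1 + 1) (n + 1) s (j' 0) :=
      ⟨j'', z0, by rw [hj'', Function.update_self], hb, hst⟩
    have hold : ¬ StartsAt K (r + 1 + 1) n s (j' 0) := by
      rintro ⟨i, h0, hn, hi, -⟩
      have := hi.unique hK hb (by omega) (r + 1) le_rfl
      have := hi.1 (r + 1) (by omega)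
      omega
    rw [← Set.ncard_insert_of_notMem (a := j' 0) (by exact hold) (finite_startsAt ..)]
    congr 1
    ext b
    simp only [Set.mem_ofPred_eq, Set.mem_insert_iff]
    constructor
    · intro hbs
      rcases lt_trichotomy b (j' 0) with hlt | heq | hlt
      · exact Or.inr (hbs.of_lt (hK 0 (by omega)) hnew hlt)
      · exact Or.inl heq
      · exact absurd (hnew.of_lt (hK 0 (by omega)) hbs hlt) hold
    · rintro (rfl | h)
      · exact hnew
      · exact h.succ
  · rw [add_zero]
    congr 1
    ext b
    simp only [Set.mem_ofPred_eq]
    refine ⟨?_, fun h => h.succ⟩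
    rintro ⟨j, h0, hn, hj, hst⟩
    have := hj.1 r (by omega)
    by_cases hle : j r + K r ≤ n
    · refine ⟨Function.update j (r + 1) (min n (j (r + 1))),
        by rw [Function.update_of_ne (by omega)]; exact h0, by simp,
        (hj.le (Nat.le_succ r)).snoc (by omega) fun t h1 h2 => hj.2 r (by omega) t h1 (by omega), hst⟩
    · exact absurd ⟨j r, by omega, ⟨j, rfl, hj.le (Nat.le_succ r)⟩,
        fun t h1 h2 => hj.2 r (by omega) t h1 (by omega)⟩ hc

theorem CompletesAt.last {K : ℕ → ℕ} {r n : ℕ} {s : ℕ → ℕ} (hK : 0 < K r)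
    (h : CompletesAt K r (n + 1) s) : s n = r := by
  obtain ⟨e, he, -, hs⟩ := h
  exact hs n (by omega) (by omega)

theorem startCount_add {K : ℕ → ℕ} {r n d : ℕ} {s : ℕ → ℕ} (hr : 0 < r)
    (hK : ∀ i ≤ r, 0 < K i) (h : ∀ t, n ≤ t → t < n + d → ¬ CompletesAt K r (t + 1) s) :
    startCount K (r + 1) (n + d) s = startCount K (r + 1) n s := by
  induction d with
  | zero => rfl
  | succ d ih =>
    rw [← add_assoc, startCount_succ hr hK, if_neg (h (n + d) (by omega) (by omega)), add_zero,
      ih fun t h1 h2 => h t h1 (by omega)]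

theorem startCount_eq_of_completesAt {K : ℕ → ℕ} {r n : ℕ} {s : ℕ → ℕ} (hr : 0 < r)
    (hK : ∀ i ≤ r, 0 < K i) {e : ℕ} (he : e + K r = n + 1) (hb : BlocksEndAt K r e s) :
    startCount K (r + 1) n s = startCount K (r + 1) e s := by
  obtain ⟨r, rfl⟩ : ∃ q, r = q + 1 := ⟨r - 1, by omega⟩
  have hk := hK (r + 1) le_rfl
  obtain ⟨d, rfl⟩ : ∃ d, n = e + d := ⟨n - e, by omega⟩
  refine startCount_add hr hK fun t h1 h2 => ?_
  rintro ⟨e', he', -, hs⟩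
  have := hb.last (hK r (by omega))
  have := hb.pos (hK r (by omega))
  have := hs (e - 1) (by omega) (by omega)
  omega

theorem blocksEndAt_succ_iff {K : ℕ → ℕ} {m n : ℕ} {s : ℕ → ℕ} (hK : 0 < K m) :
    BlocksEndAt K (m + 1) (n + 1) s ↔
      (s n = m ∧ BlocksEndAt K (m + 1) n s) ∨ CompletesAt K m (n + 1) s := by
  constructor
  · rintro ⟨j, hj, hb⟩
    have h1 := hb.1 m (by omega)
    by_cases hc : j m + K m = n + 1
    · exact Or.inr ⟨j m, hc, ⟨j, rfl, hb.le (Nat.le_succ m)⟩,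
        fun t h1 h2 => hb.2 m (by omega) t h1 (by omega)⟩
    · refine Or.inl ⟨hb.2 m (by omega) n (by omega) (by omega),
        Function.update j (m + 1) n, Function.update_self ..,
        (hb.le (Nat.le_succ m)).snoc (by omega)
          fun t h1 h2 => hb.2 m (by omega) t h1 (by omega)⟩
  · rintro (⟨hs, j, hj, hb⟩ | ⟨e, he, ⟨j, hj, hb⟩, hs⟩)
    · have h1 := hb.1 m (by omega)
      refine ⟨Function.update j (m + 1) (n + 1), Function.update_self ..,
        (hb.le (Nat.le_succ m)).snoc (by omega) fun t h1 h2 => ?_⟩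
      by_cases ht : t = n
      · rw [ht, hs]
      · exact hb.2 m (by omega) t h1 (by omega)
    · exact ⟨Function.update j (m + 1) (n + 1), Function.update_self ..,
        hb.snoc (by omega) fun t h1 h2 => hs t (by omega) h2⟩

theorem not_completesAt_of_blocksEndAt {K : ℕ → ℕ} {m n : ℕ} {s : ℕ → ℕ}
    (hK : ∀ i ≤ m + 1, 0 < K i) (h : BlocksEndAt K (m + 2) n s) :
    ¬ CompletesAt K (m + 1) (n + 1) s := by
  rintro ⟨e, he, hb, hs⟩
  obtain ⟨j, hj, hbj⟩ := h
  have hj' : j (m + 1 + 1) = n := hj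
  have h1 := hbj.1 (m + 1) (by omega)
  have h2 := hb.last (hK m (by omega))
  have h3 := hb.pos (hK m (by omega))
  have h4 := hK (m + 1) le_rfl
  have := hbj.2 (m + 1) (by omega) (e - 1) (by omega) (by omega)
  omega

theorem blocksEndAt_one_iff {K : ℕ → ℕ} {n : ℕ} {s : ℕ → ℕ} :
    BlocksEndAt K 1 n s ↔ ∃ e, e + K 0 = n ∧ ∀ t, e ≤ t → t < n → s t = 0 := by
  constructor
  · rintro ⟨j, hj, hb⟩
    have := hb.1 0 (by omega)
    simp only [zero_add] at this
    exact ⟨n - K 0, by omega, fun t h1 h2 => hb.2 0 (by omega) t (by omega) (by simp; omega)⟩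
  · rintro ⟨e, he, hs⟩
    refine ⟨fun i => if i = 0 then e else n, by simp, fun i hi => ?_, fun i hi t => ?_⟩
    · obtain rfl : i = 0 := by omega
      simp [he]
    · obtain rfl : i = 0 := by omega
      simpa using hs t

theorem completesAt_iff {K : ℕ → ℕ} {m n : ℕ} {s : ℕ → ℕ} :
    CompletesAt K m n s ↔
      (K m ≤ n ∧ ∀ t, n - K m ≤ t → t < n → s t = m) ∧ BlocksEndAt K m (n - K m) s := by
  constructor
  · rintro ⟨e, rfl, hb, hs⟩
    simp only [Nat.add_sub_cancel]
    exact ⟨⟨by omega, hs⟩, hb⟩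
  · rintro ⟨⟨h1, h2⟩, h3⟩
    exact ⟨n - K m, by omega, h3, h2⟩

/-- The infinite sequence of naturals extending a finite word by zeros. -/
def extendWord {ℓ n : ℕ} (s : Fin n → Fin ℓ) (t : ℕ) : ℕ :=
  if h : t < n then (s ⟨t, h⟩ : ℕ) else 0

theorem extendWord_snoc {ℓ n : ℕ} (s : Fin n → Fin ℓ) (c : Fin ℓ) {t : ℕ} (ht : t < n) :
    extendWord (Fin.snoc s c : Fin (n + 1) → Fin ℓ) t = extendWord s t := by
  have h : (⟨t, by omega⟩ : Fin (n + 1)) = Fin.castSucc ⟨t, ht⟩ := rfl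
  rw [extendWord, dif_pos (by omega), h, Fin.snoc_castSucc, extendWord, dif_pos ht]

theorem extendWord_snoc_last {ℓ n : ℕ} (s : Fin n → Fin ℓ) (c : Fin ℓ) :
    extendWord (Fin.snoc s c : Fin (n + 1) → Fin ℓ) n = c := by
  have h : (⟨n, by omega⟩ : Fin (n + 1)) = Fin.last n := rfl
  rw [extendWord, dif_pos (by omega), h, Fin.snoc_last]

section GeneratingSeries

variable {A : Type*} [CommRing A]

/-- A family of functions of infinite sequences whose `n`-th member depends only on the
length-`n` prefix. -/
def IsPrefixLocal (g : ℕ → (ℕ → ℕ) → A) : Prop :=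
  ∀ n s s', (∀ t < n, s t = s' t) → g n s = g n s'

/-- The function supported on the words ending with `c`, where it is the value of `g` at the word
without its last letter. -/
def appendLetter (c : ℕ) (g : ℕ → (ℕ → ℕ) → A) : ℕ → (ℕ → ℕ) → A
  | 0, _ => 0
  | n + 1, s => if s n = c then g n s else 0

/-- The generating series of the weighted sums of `g` over words of length `n`. -/
noncomputable def wordSeries (ℓ : ℕ) (p : ℕ → A) (g : ℕ → (ℕ → ℕ) → A) : PowerSeries A :=
  PowerSeries.mk fun n => ∑ s : Fin n → Fin ℓ, (∏ t, p (s t)) * g n (extendWord s)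

theorem IsPrefixLocal.appendLetter {g : ℕ → (ℕ → ℕ) → A} (hg : IsPrefixLocal g) (c : ℕ) :
    IsPrefixLocal (appendLetter c g) := by
  rintro (_ | n) s s' hs
  · rfl
  · simp only [_root_.appendLetter, hs n (by omega)]
    rw [hg n s s' fun t ht => hs t (by omega)]

theorem appendLetter_iterate (c d : ℕ) (g : ℕ → (ℕ → ℕ) → A) (n : ℕ) (s : ℕ → ℕ)
    [Decidable (d ≤ n ∧ ∀ t, n - d ≤ t → t < n → s t = c)] :
    (appendLetter c)^[d] g n s =
      if d ≤ n ∧ ∀ t, n - d ≤ t → t < n → s t = c then g (n - d) s else 0 := by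
  classical
  induction d generalizing n with
  | zero =>
    rw [if_pos ⟨by omega, fun t h1 h2 => by omega⟩]
    rfl
  | succ d ih =>
    rw [Function.iterate_succ_apply']
    rcases n with _ | n
    · rw [if_neg (by omega)]
      rfl
    · simp only [appendLetter, ih, Nat.add_sub_add_right]
      rw [← ite_and]
      refine if_congr ⟨fun ⟨h1, h2, h3⟩ => ⟨by omega, fun t h4 h5 => ?_⟩,
        fun ⟨h1, h2⟩ => ⟨h2 n (by omega) (by omega), by omega,
          fun t h3 h4 => h2 t h3 (by omega)⟩⟩ rfl rfl
      by_cases ht : t = n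
      · rw [ht, h1]
      · exact h3 t h4 (by omega)

theorem sum_word_succ (ℓ n : ℕ) (p : ℕ → A) (f : (Fin (n + 1) → Fin ℓ) → A) :
    ∑ s : Fin (n + 1) → Fin ℓ, (∏ t, p (s t)) * f s =
      ∑ s : Fin n → Fin ℓ, ∑ c : Fin ℓ, (∏ t, p (s t)) * p c * f (Fin.snoc s c) := by
  rw [← (Fin.snocEquiv fun _ : Fin (n + 1) => Fin ℓ).sum_comp, Fintype.sum_prod_type_right]
  refine Finset.sum_congr rfl fun s _ => Finset.sum_congr rfl fun c _ => ?_
  rw [Fin.prod_univ_castSucc]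
  simp [Fin.snocEquiv]

theorem wordSeries_appendLetter {ℓ : ℕ} (p : ℕ → A) {g : ℕ → (ℕ → ℕ) → A}
    (hg : IsPrefixLocal g) {c : ℕ} (hc : c < ℓ) :
    wordSeries ℓ p (appendLetter c g) =
      PowerSeries.C (p c) * PowerSeries.X * wordSeries ℓ p g := by
  ext n
  rw [mul_assoc, PowerSeries.coeff_C_mul]
  rcases n with _ | n
  · simp [wordSeries, appendLetter]
  · rw [PowerSeries.coeff_succ_X_mul]
    simp only [wordSeries, PowerSeries.coeff_mk]
    rw [sum_word_succ, Finset.mul_sum]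
    refine Finset.sum_congr rfl fun s _ => ?_
    rw [Finset.sum_eq_single ⟨c, hc⟩]
    · simp only [appendLetter, extendWord_snoc_last, if_true]
      rw [hg n _ _ fun t ht => extendWord_snoc s ⟨c, hc⟩ ht]
      ring
    · intro d _ hd
      have : (d : ℕ) ≠ c := fun h => hd (Fin.ext h)
      simp [appendLetter, extendWord_snoc_last, this]
    · simp

theorem wordSeries_appendLetter_iterate {ℓ : ℕ} (p : ℕ → A) {g : ℕ → (ℕ → ℕ) → A}
    (hg : IsPrefixLocal g) {c : ℕ} (hc : c < ℓ) (d : ℕ) :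
    wordSeries ℓ p ((appendLetter c)^[d] g) =
      (PowerSeries.C (p c) * PowerSeries.X) ^ d * wordSeries ℓ p g := by
  induction d generalizing g with
  | zero => simp
  | succ d ih =>
    rw [Function.iterate_succ_apply, ih (hg.appendLetter c), wordSeries_appendLetter p hg hc]
    ring

theorem wordSeries_add (ℓ : ℕ) (p : ℕ → A) (f g : ℕ → (ℕ → ℕ) → A) :
    wordSeries ℓ p (f + g) = wordSeries ℓ p f + wordSeries ℓ p g := by
  ext n
  simp [wordSeries, mul_add, Finset.sum_add_distrib]

variable (K : ℕ → ℕ) (r : ℕ) (w : A)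

/-- The monomial recording the number of occurrences in a prefix. -/
noncomputable def countWeight (n : ℕ) (s : ℕ → ℕ) : A := w ^ startCount K (r + 1) n s

open Classical in
/-- `countWeight` restricted to the words ending with blocks of `0, …, m - 1`. -/
noncomputable def blocksWeight (m n : ℕ) (s : ℕ → ℕ) : A :=
  if BlocksEndAt K m n s then countWeight K r w n s else 0

theorem isPrefixLocal_countWeight : IsPrefixLocal (countWeight K r w) := fun n s s' hs => by
  rw [countWeight, countWeight, startCount_congr hs]

theorem isPrefixLocal_blocksWeight (m : ℕ) : IsPrefixLocal (blocksWeight K r w m) :=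
  fun n s s' hs => by
    classical
    simp only [blocksWeight, isPrefixLocal_countWeight K r w n s s' hs]
    exact if_congr (blocksEndAt_congr hs) rfl rfl

variable {K r}

open Classical in
theorem appendLetter_iterate_blocksWeight (m n : ℕ) (s : ℕ → ℕ) :
    (appendLetter m)^[K m] (blocksWeight K r w m) n s =
      if CompletesAt K m n s then countWeight K r w (n - K m) s else 0 := by
  rw [appendLetter_iterate, blocksWeight, ← ite_and]
  exact if_congr completesAt_iff.symm rfl rfl

theorem countWeight_sub (hr : 0 < r) (hK : ∀ i ≤ r, 0 < K i) {d n : ℕ} {s : ℕ → ℕ} (hd : d ≤ n)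
    (hs : ∀ t, n - d ≤ t → t < n → s t ≠ r) :
    countWeight K r w (n - d) s = countWeight K r w n s := by
  have := startCount_add (n := n - d) (d := d) (s := s) hr hK fun t h1 h2 h =>
    hs t h1 (by omega) (h.last (hK r le_rfl))
  rw [Nat.sub_add_cancel hd] at this
  rw [countWeight, countWeight, this]

theorem blocksWeight_one (hr : 0 < r) (hK : ∀ i ≤ r, 0 < K i) :
    blocksWeight K r w 1 = (appendLetter 0)^[K 0] (countWeight K r w) := by
  classical
  funext n s
  rw [appendLetter_iterate, blocksWeight]
  by_cases h : K 0 ≤ n ∧ ∀ t, n - K 0 ≤ t → t < n → s t = 0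
  · rw [if_pos h, if_pos (blocksEndAt_one_iff.2 ⟨n - K 0, by omega, h.2⟩),
      countWeight_sub w hr hK h.1 fun t h1 h2 => by rw [h.2 t h1 h2]; omega]
  · rw [if_neg h, if_neg]
    intro hb
    obtain ⟨e, rfl, hs⟩ := blocksEndAt_one_iff.1 hb
    exact h ⟨by omega, by rwa [Nat.add_sub_cancel]⟩

theorem blocksWeight_succ (hr : 0 < r) (hK : ∀ i ≤ r, 0 < K i) {m : ℕ} (hm : m + 1 < r) :
    blocksWeight K r w (m + 2) =
      appendLetter (m + 1) (blocksWeight K r w (m + 2)) +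
        (appendLetter (m + 1))^[K (m + 1)] (blocksWeight K r w (m + 1)) := by
  classical
  have hKm := hK (m + 1) hm.le
  funext n s
  rw [Pi.add_apply, Pi.add_apply, appendLetter_iterate_blocksWeight]
  rcases n with _ | n
  · rw [blocksWeight, if_neg fun h => absurd (h.pos hKm) (by omega),
      if_neg fun h => by obtain ⟨e, he, -⟩ := h; omega]
    simp [appendLetter]
  · have hiff := blocksEndAt_succ_iff (n := n) (s := s) hKm
    by_cases hc : CompletesAt K (m + 1) (n + 1) s
    · have hn : ¬ BlocksEndAt K (m + 2) n s := fun h =>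
        not_completesAt_of_blocksEndAt (fun i hi => hK i (by omega)) h hc
      have hc' := (completesAt_iff.1 hc).1
      simp only [appendLetter, blocksWeight]
      rw [if_pos (hiff.2 (Or.inr hc)), if_neg hn, if_pos hc, ite_self, zero_add,
        countWeight_sub w hr hK hc'.1 fun t h1 h2 => by rw [hc'.2 t h1 h2]; omega]
    · rw [if_neg hc, add_zero]
      simp only [appendLetter, blocksWeight]
      rw [← ite_and]
      by_cases h : s n = m + 1 ∧ BlocksEndAt K (m + 2) n s
      · rw [if_pos h, if_pos (hiff.2 (Or.inl h))]
        exact (countWeight_sub w hr hK (d := 1) (n := n + 1) (by omega) fun t h1 h2 => by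
          obtain rfl : t = n := by omega
          omega).symm
      · rw [if_neg h, if_neg fun h' => (hiff.1 h').elim h hc]

theorem countWeight_succ (hr : 0 < r) (hK : ∀ i ≤ r, 0 < K i) (n : ℕ) (s : ℕ → ℕ) :
    countWeight K r w (n + 1) s = countWeight K r w n s +
      (w - 1) * (appendLetter r)^[K r] (blocksWeight K r w r) (n + 1) s := by
  classical
  rw [appendLetter_iterate_blocksWeight, countWeight, startCount_succ hr hK]
  split_ifs with h
  · obtain ⟨e, he, hb, -⟩ := h
    rw [← he, Nat.add_sub_cancel, countWeight, countWeight,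
      startCount_eq_of_completesAt hr hK he hb]
    ring
  · simp [countWeight]

theorem startCount_eq_zero {m n : ℕ} (s : ℕ → ℕ) (hn : n < ∑ i ∈ Finset.range m, K i) :
    startCount K m n s = 0 := by
  rw [startCount, Set.ncard_eq_zero (finite_startsAt ..), Set.eq_empty_iff_forall_notMem]
  exact fun j hj => absurd (StartsAt.sum_le hj) (not_le.2 hn)

variable (p : ℕ → A)

theorem wordSeries_blocksWeight (hr : 0 < r) (hK : ∀ i ≤ r, 0 < K i) {m : ℕ} (hm : m < r) :
    (∏ i ∈ Finset.Ico 1 (m + 1), (1 - PowerSeries.C (p i) * PowerSeries.X)) *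
        wordSeries (r + 1) p (blocksWeight K r w (m + 1)) =
      (∏ i ∈ Finset.range (m + 1), (PowerSeries.C (p i) * PowerSeries.X) ^ K i) *
        wordSeries (r + 1) p (countWeight K r w) := by
  induction m with
  | zero =>
    rw [zero_add, blocksWeight_one w hr hK,
      wordSeries_appendLetter_iterate p (isPrefixLocal_countWeight K r w) (by omega)]
    simp
  | succ m ih =>
    have h := congrArg (wordSeries (r + 1) p) (blocksWeight_succ w hr hK hm)
    rw [wordSeries_add, wordSeries_appendLetter p (isPrefixLocal_blocksWeight K r w _) (by omega),
      wordSeries_appendLetter_iterate p (isPrefixLocal_blocksWeight K r w _) (by omega)] at h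
    have ih := ih (by omega)
    rw [Finset.prod_Ico_succ_top (by omega), Finset.prod_range_succ]
    linear_combination (∏ i ∈ Finset.Ico 1 (m + 1), (1 - PowerSeries.C (p i) * PowerSeries.X)) * h
      + (PowerSeries.C (p (m + 1)) * PowerSeries.X) ^ K (m + 1) * ih

theorem wordSeries_countWeight (hr : 0 < r) (hK : ∀ i ≤ r, 0 < K i)
    (hp : ∑ i ∈ Finset.range (r + 1), p i = 1) :
    wordSeries (r + 1) p (countWeight K r w) =
      1 + PowerSeries.X * wordSeries (r + 1) p (countWeight K r w) +
        PowerSeries.C (w - 1) *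
          wordSeries (r + 1) p ((appendLetter r)^[K r] (blocksWeight K r w r)) := by
  ext n
  rw [map_add, map_add, PowerSeries.coeff_C_mul]
  rcases n with _ | n
  · have h0 : 0 < ∑ i ∈ Finset.range (r + 1), K i :=
      Finset.sum_pos (fun i hi => hK i (by simp at hi; omega)) (by simp)
    have hc : ∀ s, ¬ CompletesAt K r 0 s := fun s ⟨e, he, _⟩ => by
      have := hK r le_rfl
      omega
    simp [wordSeries, countWeight, startCount_eq_zero _ h0, appendLetter_iterate_blocksWeight, hc]
  · rw [PowerSeries.coeff_succ_X_mul, PowerSeries.coeff_one, if_neg (by omega), zero_add]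
    simp only [wordSeries, PowerSeries.coeff_mk]
    simp only [countWeight_succ w hr hK, mul_add, Finset.sum_add_distrib]
    congr 1
    · rw [sum_word_succ]
      refine Finset.sum_congr rfl fun s _ => ?_
      rw [Finset.sum_range] at hp
      have : ∀ c : Fin (r + 1), countWeight K r w n (extendWord (Fin.snoc s c : Fin (n + 1) → _)) =
          countWeight K r w n (extendWord s) := fun c =>
        isPrefixLocal_countWeight K r w n _ _ fun t ht => extendWord_snoc s c ht
      simp only [this]
      rw [← Finset.sum_mul, ← Finset.mul_sum, hp, mul_one]
    · rw [Finset.mul_sum]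
      exact Finset.sum_congr rfl fun s _ => by ring

theorem wordSeries_functional_equation (hr : 0 < r) (hK : ∀ i ≤ r, 0 < K i)
    (hp : ∑ i ∈ Finset.range (r + 1), p i = 1) :
    (1 - PowerSeries.X) * (∏ i ∈ Finset.Ico 1 r, (1 - PowerSeries.C (p i) * PowerSeries.X)) *
        wordSeries (r + 1) p (countWeight K r w) =
      (∏ i ∈ Finset.Ico 1 r, (1 - PowerSeries.C (p i) * PowerSeries.X)) +
        PowerSeries.C ((w - 1) * ∏ i ∈ Finset.range (r + 1), p i ^ K i) *
          (PowerSeries.X ^ (∑ i ∈ Finset.range (r + 1), K i) *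
            wordSeries (r + 1) p (countWeight K r w)) := by
  have h1 := wordSeries_countWeight w p hr hK hp
  rw [wordSeries_appendLetter_iterate p (isPrefixLocal_blocksWeight K r w _) (by omega)] at h1
  obtain ⟨q, rfl⟩ : ∃ q, r = q + 1 := ⟨r - 1, by omega⟩
  have h2 := wordSeries_blocksWeight w p hr hK (Nat.lt_succ_self q)
  have h3 : PowerSeries.C (∏ i ∈ Finset.range (q + 1 + 1), p i ^ K i) *
      PowerSeries.X ^ (∑ i ∈ Finset.range (q + 1 + 1), K i) =
      (∏ i ∈ Finset.range (q + 1), (PowerSeries.C (p i) * PowerSeries.X) ^ K i) *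
        (PowerSeries.C (p (q + 1)) * PowerSeries.X) ^ K (q + 1) := by
    rw [← Finset.prod_range_succ, ← Finset.prod_pow_eq_pow_sum, map_prod,
      ← Finset.prod_mul_distrib]
    simp only [map_pow, mul_pow]
  rw [map_mul]
  linear_combination
    (∏ i ∈ Finset.Ico 1 (q + 1), (1 - PowerSeries.C (p i) * PowerSeries.X)) * h1 +
      PowerSeries.C (w - 1) * (PowerSeries.C (p (q + 1)) * PowerSeries.X) ^ K (q + 1) * h2 -
      PowerSeries.C (w - 1) *
        wordSeries (q + 1 + 1) p (countWeight K (q + 1) w) * h3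

end GeneratingSeries

theorem patCount_eq_startCount {ℓ n : ℕ} {k : Fin ℓ → ℕ} {K : ℕ → ℕ} (hk : ∀ i, k i = K i)
    (s : Fin n → Fin ℓ) : patCount ℓ n k s = startCount K ℓ n (extendWord s) := by
  have hs : ∀ t (ht : t < n), extendWord s t = s ⟨t, ht⟩ := fun t ht => dif_pos ht
  rw [patCount, startCount]
  congr 1
  ext j₀
  constructor
  · rintro ⟨j, h0, hn, h1, h2, h3⟩
    have hmono : ∀ i ≤ ℓ, ∀ d ≤ i, j d ≤ j i := fun i => by
      induction i with
      | zero =>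
        intro _ d hd
        rw [Nat.le_zero.1 hd]
      | succ i ih =>
        intro hi d hd
        rcases Nat.le_succ_iff.1 hd with hd | rfl
        · have h4 := ih (by omega) d hd
          have h5 := h1 ⟨i, hi⟩
          simp only at h5
          omega
        · exact le_rfl
    refine ⟨j, h0, hn, ⟨fun i hi => hk ⟨i, hi⟩ ▸ h1 ⟨i, hi⟩, fun i hi t h4 h5 => ?_⟩, ?_⟩
    · have := hmono ℓ le_rfl (i + 1) hi
      have ht : t < n := by omega
      rw [hs t ht]
      exact h2 ⟨i, hi⟩ t ht h4 h5
    · refine h3.imp_right ?_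
      rintro ⟨h, h4⟩
      rwa [hs _ h]
  · rintro ⟨j, h0, hn, hj, h3⟩
    refine ⟨j, h0, hn, fun i => hk i ▸ hj.1 i i.2,
      fun i t ht h1 h2 => hs t ht ▸ hj.2 i i.2 t h1 h2, ?_⟩
    have := hj.mono (Nat.zero_le ℓ) le_rfl
    by_cases hz : j₀ = 0
    · exact Or.inl hz
    · have hlt : j₀ - 1 < n := by omega
      exact Or.inr ⟨hlt, hs _ hlt ▸ h3.resolve_left hz⟩

theorem Fpoly_eq_coeff {r n : ℕ} {k : Fin (r + 1) → ℕ} {K : ℕ → ℕ} (hk : ∀ i, k i = K i)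
    {p : Fin (r + 1) → ℝ} {P : ℕ → ℝ} (hp : ∀ i, p i = P i) :
    Fpoly (r + 1) n k p = PowerSeries.coeff n
      (wordSeries (r + 1) (fun i => Polynomial.C (P i)) (countWeight K r Polynomial.X)) := by
  simp only [Fpoly, wordSeries, PowerSeries.coeff_mk, countWeight, wt, hp, map_prod,
    patCount_eq_startCount hk]

theorem Fpoly_eq_one {ℓ n : ℕ} {k : Fin ℓ → ℕ} {p : Fin ℓ → ℝ} (hsum : ∑ i, p i = 1)
    (h : ∀ s : Fin n → Fin ℓ, patCount ℓ n k s = 0) : Fpoly ℓ n k p = 1 := by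
  simp only [Fpoly, h, pow_zero, mul_one, wt]
  rw [← map_sum, ← Fintype.sum_pow, hsum, one_pow, map_one]

theorem prod_filter_fin_eq_prod_Ico {M : Type*} [CommMonoid M] (r : ℕ) (f : ℕ → M) :
    ∏ i ∈ Finset.univ.filter (fun i : Fin (r + 1) => 0 < (i : ℕ) ∧ (i : ℕ) < r), f i =
      ∏ i ∈ Finset.Ico 1 r, f i := by
  rw [Finset.prod_filter, Fin.prod_univ_eq_prod_range (fun i => if 0 < i ∧ i < r then f i else 1),
    ← Finset.prod_filter]
  refine Finset.prod_congr ?_ fun _ _ => rfl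
  ext i
  simp only [Finset.mem_filter, Finset.mem_range, Finset.mem_Ico]
  omega

/-- The embedding of polynomials over `ℝ` into power series over `ℝ[X]`, the variable of the former
being sent to the variable of the latter. -/
noncomputable def polynomialToSeries : Polynomial ℝ →+* PowerSeries (Polynomial ℝ) :=
  Polynomial.coeToPowerSeries.ringHom.comp (Polynomial.mapRingHom Polynomial.C)

theorem polynomialToSeries_C (x : ℝ) :
    polynomialToSeries (Polynomial.C x) = PowerSeries.C (Polynomial.C x) := by
  simp [polynomialToSeries]

theorem polynomialToSeries_X : polynomialToSeries Polynomial.X = PowerSeries.X := by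
  simp [polynomialToSeries]

theorem coeff_polynomialToSeries (f : Polynomial ℝ) (n : ℕ) :
    PowerSeries.coeff n (polynomialToSeries f) = Polynomial.C (f.coeff n) := by
  simp [polynomialToSeries]

theorem natDegree_prod_one_sub_C_mul_X_le {ι : Type*} (s : Finset ι) (p : ι → ℝ) :
    (∏ i ∈ s, (1 - Polynomial.C (p i) * Polynomial.X)).natDegree ≤ s.card := by
  refine (Polynomial.natDegree_prod_le _ _).trans ?_
  rw [Finset.card_eq_sum_ones]
  refine Finset.sum_le_sum fun i _ => ?_
  refine (Polynomial.natDegree_sub_le _ _).trans ?_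
  simp only [Polynomial.natDegree_one, zero_le, max_eq_right]
  exact (Polynomial.natDegree_C_mul_le _ _).trans Polynomial.natDegree_X_le

theorem statement9 (ℓ : ℕ) (hℓ : 2 ≤ ℓ) (k : Fin ℓ → ℕ) (hk : ∀ i, 0 < k i)
    (p : Fin ℓ → ℝ) (hp : ∀ i, 0 ≤ p i) (hsum : ∑ i, p i = 1)
    (a : ℕ → ℝ)
    (ha : (1 - Polynomial.X) *
        ∏ i ∈ Finset.univ.filter (fun i : Fin ℓ => 0 < (i : ℕ) ∧ (i : ℕ) < ℓ - 1),
          (1 - Polynomial.C (p i) * Polynomial.X) =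
      1 - ∑ j ∈ Finset.Icc 1 (ℓ - 1), Polynomial.C (a j) * Polynomial.X ^ j) :
    (∀ n, n < ∑ i, k i → Fpoly ℓ n k p = 1) ∧
    ∀ n, ∑ i, k i ≤ n →
      Fpoly ℓ n k p =
        (∑ j ∈ Finset.Icc 1 (ℓ - 1), Polynomial.C (a j) * Fpoly ℓ (n - j) k p) +
          (Polynomial.X - 1) * Polynomial.C (∏ i, p i ^ k i) *
            Fpoly ℓ (n - ∑ i, k i) k p := by
  obtain ⟨r, rfl⟩ : ∃ r, ℓ = r + 1 := ⟨ℓ - 1, by omega⟩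
  rw [Nat.add_sub_cancel] at *
  obtain ⟨K, hkK⟩ : ∃ K : ℕ → ℕ, ∀ i, k i = K i :=
    ⟨fun i => if h : i < r + 1 then k ⟨i, h⟩ else 0, fun i => by simp only [i.2, dif_pos]⟩
  obtain ⟨P, hpP⟩ : ∃ P : ℕ → ℝ, ∀ i, p i = P i :=
    ⟨fun i => if h : i < r + 1 then p ⟨i, h⟩ else 0, fun i => by simp only [i.2, dif_pos]⟩
  have hK : ∀ i ≤ r, 0 < K i := fun i hi => by
    have := hk ⟨i, by omega⟩
    rwa [hkK] at this
  have hsumK : ∑ i, k i = ∑ i ∈ Finset.range (r + 1), K i := by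
    simp only [hkK, Finset.sum_range]
  have hr : r + 1 ≤ ∑ i ∈ Finset.range (r + 1), K i := by
    simpa using Finset.card_nsmul_le_sum (Finset.range (r + 1)) K 1 fun i hi =>
      hK i (by simp at hi; omega)
  refine ⟨fun n hn => Fpoly_eq_one hsum fun s => ?_, fun n hn => ?_⟩
  · rw [patCount_eq_startCount hkK, startCount_eq_zero _ (hsumK ▸ hn)]
  have hprod : ∏ i, p i ^ k i = ∏ i ∈ Finset.range (r + 1), P i ^ K i := by
    simp only [hkK, hpP, Finset.prod_range]
  rw [hsumK] at hn ⊢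
  have hP : ∑ i ∈ Finset.range (r + 1), (Polynomial.C (P i) : Polynomial ℝ) = 1 := by
    rw [← map_sum, Finset.sum_range]
    simp only [← hpP, hsum, map_one]
  have key := wordSeries_functional_equation (Polynomial.X : Polynomial ℝ)
    (fun i => Polynomial.C (P i)) (by omega) hK hP
  simp only [hpP] at ha
  rw [prod_filter_fin_eq_prod_Ico r fun i => 1 - Polynomial.C (P i) * Polynomial.X] at ha
  have hQ : ∏ i ∈ Finset.Ico 1 r, (1 - PowerSeries.C (Polynomial.C (P i)) * PowerSeries.X) =
      polynomialToSeries (∏ i ∈ Finset.Ico 1 r, (1 - Polynomial.C (P i) * Polynomial.X)) := by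
    simp only [map_prod, map_sub, map_one, map_mul, polynomialToSeries_C, polynomialToSeries_X]
  have hdeg : (∏ i ∈ Finset.Ico 1 r, (1 - Polynomial.C (P i) * Polynomial.X)).coeff n = 0 := by
    refine Polynomial.coeff_eq_zero_of_natDegree_lt
      ((natDegree_prod_one_sub_C_mul_X_le _ _).trans_lt ?_)
    rw [Nat.card_Ico]
    omega
  have ha' := congrArg polynomialToSeries ha
  rw [map_mul, ← hQ] at ha'
  simp only [map_sub, map_one, map_sum, map_mul, map_pow, polynomialToSeries_C,
    polynomialToSeries_X] at ha'
  rw [ha'] at key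
  have hcoeff := congrArg (PowerSeries.coeff n) key
  rw [hQ, map_add, coeff_polynomialToSeries, hdeg, map_zero, zero_add, PowerSeries.coeff_C_mul,
    PowerSeries.coeff_X_pow_mul', if_pos hn, sub_mul, one_mul, map_sub, Finset.sum_mul,
    map_sum] at hcoeff
  simp only [Fpoly_eq_coeff hkK hpP, hprod, map_prod, map_pow]
  rw [sub_eq_iff_eq_add'] at hcoeff
  rw [hcoeff]
  congr 1
  refine Finset.sum_congr rfl fun j hj => ?_
  rw [Finset.mem_Icc] at hj
  rw [mul_assoc, PowerSeries.coeff_C_mul, PowerSeries.coeff_X_pow_mul', if_pos (by omega)]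
end

section
/- Let ℓ = 2, let k_1, k_2 be positive integers with k = k_1+k_2, and let p_1, p_2 ≥ 0 be reals with p_1+p_2 = 1. Then for all n ≥ k, F_{2,n}(w) = F_{2,n−1}(w) + (w−1) p_1^{k_1} p_2^{k_2} F_{2,n−k}(w) as polynomials in w. -/
/-- The extension of a finite binary sequence by zeros. -/
def extendZero {n : ℕ} (s : Fin n → Fin 2) (t : ℕ) : Fin 2 :=
  if h : t < n then s ⟨t, h⟩ else 0

lemma extendZero_of_lt {n : ℕ} (s : Fin n → Fin 2) {t : ℕ} (h : t < n) :
    extendZero s t = s ⟨t, h⟩ := dif_pos h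

/-- The word `0^{k₁} 1^{k₂}` is read in `g` from position `a` on. -/
def WordAt (k₁ k₂ : ℕ) (g : ℕ → Fin 2) (a : ℕ) : Prop :=
  ∀ t < k₁ + k₂, g (a + t) = if t < k₁ then 0 else 1

lemma WordAt.eq_zero {k₁ k₂ a t : ℕ} {g : ℕ → Fin 2} (h : WordAt k₁ k₂ g a)
    (h₁ : a ≤ t) (h₂ : t < a + k₁) : g t = 0 := by
  have := h (t - a) (by omega)
  rwa [Nat.add_sub_cancel' h₁, if_pos (by omega)] at this

lemma WordAt.eq_one {k₁ k₂ a t : ℕ} {g : ℕ → Fin 2} (h : WordAt k₁ k₂ g a)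
    (h₁ : a + k₁ ≤ t) (h₂ : t < a + k₁ + k₂) : g t = 1 := by
  have := h (t - a) (by omega)
  rwa [Nat.add_sub_cancel' (by omega), if_neg (by omega)] at this

/-- Two occurrences of `0^{k₁} 1^{k₂}` do not overlap. -/
lemma WordAt.add_le {k₁ k₂ a b : ℕ} {g : ℕ → Fin 2} (hk₁ : 0 < k₁) (hk₂ : 0 < k₂)
    (ha : WordAt k₁ k₂ g a) (hb : WordAt k₁ k₂ g b) (hab : a < b) : a + (k₁ + k₂) ≤ b := by
  by_contra! hlt
  rcases lt_or_ge b (a + k₁) with h | h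
  · have h0 := hb.eq_zero (t := a + k₁) h.le (by omega)
    have h1 := ha.eq_one (t := a + k₁) le_rfl (by omega)
    simp [h0] at h1
  · have h0 := hb.eq_zero (t := b) le_rfl (by omega)
    have h1 := ha.eq_one (t := b) h (by omega)
    simp [h0] at h1

open Classical in
/-- The number of occurrences of `0^{k₁} 1^{k₂}` as a factor of the first `n` letters of `g`. -/
noncomputable def wordCount (k₁ k₂ n : ℕ) (g : ℕ → Fin 2) : ℕ :=
  ((Finset.range (n + 1 - (k₁ + k₂))).filter (WordAt k₁ k₂ g)).card

lemma wordCount_congr {k₁ k₂ n : ℕ} {g g' : ℕ → Fin 2} (h : ∀ t < n, g t = g' t) :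
    wordCount k₁ k₂ n g = wordCount k₁ k₂ n g' := by
  classical
  unfold wordCount
  congr 1
  refine Finset.filter_congr fun a ha => ?_
  rw [Finset.mem_range] at ha
  exact forall₂_congr fun t ht => by rw [h _ (by omega)]

lemma wordCount_succ (k₁ k₂ m n : ℕ) (hn : n + 1 = m + (k₁ + k₂)) (g : ℕ → Fin 2)
    [Decidable (WordAt k₁ k₂ g m)] :
    wordCount k₁ k₂ (n + 1) g =
      wordCount k₁ k₂ n g + if WordAt k₁ k₂ g m then 1 else 0 := by
  classical
  unfold wordCount
  rw [show n + 1 + 1 - (k₁ + k₂) = m + 1 by omega, show n + 1 - (k₁ + k₂) = m by omega,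
    Finset.range_add_one, Finset.filter_insert]
  split_ifs with h
  · rw [Finset.card_insert_of_notMem (by simp)]
  · rfl

lemma WordAt.wordCount_eq {k₁ k₂ m n : ℕ} (hk₁ : 0 < k₁) (hk₂ : 0 < k₂)
    (hn : n + 1 = m + (k₁ + k₂)) {g : ℕ → Fin 2} (hm : WordAt k₁ k₂ g m) :
    wordCount k₁ k₂ n g = wordCount k₁ k₂ m g := by
  classical
  unfold wordCount
  congr 1
  ext a
  simp only [Finset.mem_filter, Finset.mem_range]
  refine and_congr_left fun ha => ⟨fun h => ?_, fun h => by omega⟩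
  have := ha.add_le hk₁ hk₂ hm (by omega)
  omega

lemma occursAt_two_iff {k₁ k₂ n : ℕ} (hk₁ : 0 < k₁) (s : Fin n → Fin 2) (j₀ : ℕ) :
    OccursAt 2 n ![k₁, k₂] s j₀ ↔ ∃ j₁ j₂, j₂ ≤ n ∧ j₀ + k₁ ≤ j₁ ∧ j₁ + k₂ ≤ j₂ ∧
      (∀ t, j₀ ≤ t → t < j₁ → extendZero s t = 0) ∧
      (∀ t, j₁ ≤ t → t < j₂ → extendZero s t = 1) ∧
      (j₀ = 0 ∨ extendZero s (j₀ - 1) ≠ 0) := by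
  constructor
  · rintro ⟨j, rfl, h2, hj, hs, h0⟩
    have a0 := hj 0
    have a1 := hj 1
    have b0 := hs 0
    have b1 := hs 1
    simp only [Fin.val_zero, Fin.val_one, zero_add, Matrix.cons_val_zero, Matrix.cons_val_one,
      Nat.reduceAdd] at a0 a1 b0 b1
    refine ⟨j 1, j 2, h2, a0, a1, fun t h h' => ?_, fun t h h' => ?_, h0.imp_right ?_⟩
    · rw [extendZero_of_lt s (by omega)]
      exact Fin.ext (b0 t (by omega) h h')
    · rw [extendZero_of_lt s (by omega)]
      exact Fin.ext (b1 t (by omega) h h')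
    · rintro ⟨h, hne⟩ he
      rw [extendZero_of_lt s h] at he
      exact hne (by simp [he])
  · rintro ⟨j₁, j₂, h2, a0, a1, b0, b1, h0⟩
    refine ⟨fun i => if i = 0 then j₀ else if i = 1 then j₁ else j₂, by simp, by simpa using h2,
      ?_, ?_, h0.imp_right fun h => ⟨by omega, fun he => h ?_⟩⟩
    · intro i
      fin_cases i
      · simpa using a0
      · simpa using a1
    · intro i t ht
      rw [← extendZero_of_lt s ht]
      fin_cases i
      · intro h h'
        simp [b0 t (by simpa using h) (by simpa using h')]
      · intro h h'
        simp [b1 t (by simpa using h) (by simpa using h')]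
    · rw [extendZero_of_lt s (by omega)]
      exact Fin.ext he

/-- The start of the run of zeros of `g` that precedes position `a`. -/
noncomputable def runStart (g : ℕ → Fin 2) (a : ℕ) : ℕ :=
  sInf {b | b ≤ a ∧ ∀ t, b ≤ t → t < a → g t = 0}

lemma runStart_mem (g : ℕ → Fin 2) (a : ℕ) :
    runStart g a ≤ a ∧ ∀ t, runStart g a ≤ t → t < a → g t = 0 :=
  Nat.sInf_mem (s := {b | b ≤ a ∧ ∀ t, b ≤ t → t < a → g t = 0})
    ⟨a, le_rfl, fun t h h' => by omega⟩

lemma runStart_eq_zero_or (g : ℕ → Fin 2) (a : ℕ) :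
    runStart g a = 0 ∨ g (runStart g a - 1) ≠ 0 := by
  by_contra! h
  obtain ⟨hle, hz⟩ := runStart_mem g a
  have hmem : runStart g a ≤ runStart g a - 1 := by
    refine Nat.sInf_le ⟨by omega, fun t h1 h2 => ?_⟩
    rcases eq_or_lt_of_le h1 with h1 | h1
    · rw [← h1, h.2]
    · exact hz t (by omega) h2
  omega

lemma runStart_eq {g : ℕ → Fin 2} {a b : ℕ} (hba : b ≤ a) (hz : ∀ t, b ≤ t → t < a → g t = 0)
    (hb : b = 0 ∨ g (b - 1) ≠ 0) : runStart g a = b := by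
  have hle : runStart g a ≤ b := Nat.sInf_le ⟨hba, hz⟩
  by_contra hne
  have hlt : runStart g a < b := lt_of_le_of_ne hle hne
  exact hb.elim (by omega) fun h => h ((runStart_mem g a).2 _ (by omega) (by omega))

lemma patCount_two {k₁ k₂ n : ℕ} (hk₁ : 0 < k₁) (hk₂ : 0 < k₂) (s : Fin n → Fin 2) :
    patCount 2 n ![k₁, k₂] s = wordCount k₁ k₂ n (extendZero s) := by
  classical
  have himage : {j₀ : ℕ | OccursAt 2 n ![k₁, k₂] s j₀} = runStart (extendZero s) ''
      ((Finset.range (n + 1 - (k₁ + k₂))).filter (WordAt k₁ k₂ (extendZero s)) : Finset ℕ) := by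
    ext j₀
    simp only [Set.mem_ofPred_eq, occursAt_two_iff hk₁, Set.mem_image, Finset.mem_coe,
      Finset.mem_filter, Finset.mem_range]
    constructor
    · rintro ⟨j₁, j₂, h2, a0, a1, b0, b1, h0⟩
      refine ⟨j₁ - k₁, ⟨by omega, fun t ht => ?_⟩,
        runStart_eq (by omega) (fun t h h' => b0 t h (by omega)) h0⟩
      split_ifs with h
      · exact b0 _ (by omega) (by omega)
      · exact b1 _ (by omega) (by omega)
    · rintro ⟨a, ⟨ha, hw⟩, rfl⟩
      obtain ⟨hle, hz⟩ := runStart_mem (extendZero s) a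
      refine ⟨a + k₁, a + k₁ + k₂, by omega, by omega, le_rfl, fun t h h' => ?_,
        fun t h h' => hw.eq_one h h', runStart_eq_zero_or _ _⟩
      rcases lt_or_ge t a with hta | hta
      · exact hz t h hta
      · exact hw.eq_zero hta h'
  have hne : ∀ a b, WordAt k₁ k₂ (extendZero s) a → WordAt k₁ k₂ (extendZero s) b → a < b →
      runStart (extendZero s) a ≠ runStart (extendZero s) b := by
    intro a b ha hb hab he
    have h1 := ha.eq_one (t := a + k₁) le_rfl (by omega)
    have hle := ha.add_le hk₁ hk₂ hb hab
    have h0 := (runStart_mem (extendZero s) b).2 (a + k₁)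
      (by have := (runStart_mem (extendZero s) a).1; omega) (by omega)
    simp [h0] at h1
  unfold patCount wordCount
  rw [himage, Set.InjOn.ncard_image, Set.ncard_coe_finset]
  intro a ha b hb he
  simp only [Finset.mem_coe, Finset.mem_filter] at ha hb
  rcases lt_trichotomy a b with h | h | h
  · exact (hne a b ha.2 hb.2 h he).elim
  · exact h
  · exact (hne b a hb.2 ha.2 h he.symm).elim

lemma wt_append {ℓ m r : ℕ} (p : Fin ℓ → ℝ) (u : Fin m → Fin ℓ) (v : Fin r → Fin ℓ) :
    wt ℓ (m + r) p (Fin.append u v) = wt ℓ m p u * wt ℓ r p v := by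
  simp [wt, Fin.prod_univ_add]

lemma sum_wt_append {ℓ m r : ℕ} (p : Fin ℓ → ℝ) (f : (Fin (m + r) → Fin ℓ) → Polynomial ℝ)
    (φ : (Fin m → Fin ℓ) → Polynomial ℝ) (ψ : (Fin r → Fin ℓ) → Polynomial ℝ)
    (h : ∀ u v, f (Fin.append u v) = φ u * ψ v) :
    ∑ s, Polynomial.C (wt ℓ (m + r) p s) * f s =
      (∑ u, Polynomial.C (wt ℓ m p u) * φ u) * ∑ v, Polynomial.C (wt ℓ r p v) * ψ v := by
  rw [← (Fin.appendEquiv m r).sum_comp, Fintype.sum_prod_type, Finset.sum_mul_sum]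
  refine Finset.sum_congr rfl fun u _ => Finset.sum_congr rfl fun v _ => ?_
  change Polynomial.C (wt ℓ (m + r) p (Fin.append u v)) * f (Fin.append u v) = _
  rw [h, wt_append, Polynomial.C_mul]
  ring

lemma extendZero_append_left {m r : ℕ} (u : Fin m → Fin 2) (v : Fin r → Fin 2) {t : ℕ}
    (ht : t < m) : extendZero (Fin.append u v) t = extendZero u t := by
  rw [extendZero_of_lt _ ht, extendZero_of_lt _ (by omega)]
  exact Fin.append_left u v ⟨t, ht⟩

lemma extendZero_append_right {m r : ℕ} (u : Fin m → Fin 2) (v : Fin r → Fin 2) {t : ℕ}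
    (ht : t < r) : extendZero (Fin.append u v) (m + t) = v ⟨t, ht⟩ := by
  rw [extendZero_of_lt _ (by omega)]
  exact Fin.append_right u v ⟨t, ht⟩

lemma wordAt_append_iff {k₁ k₂ m : ℕ} (u : Fin m → Fin 2) (v : Fin (k₁ + k₂) → Fin 2) :
    WordAt k₁ k₂ (extendZero (Fin.append u v)) m ↔
      v = Fin.append (fun _ => 0) (fun _ => 1) := by
  have happ : ∀ t (ht : t < k₁ + k₂),
      (Fin.append (fun _ : Fin k₁ => (0 : Fin 2)) (fun _ : Fin k₂ => 1)) ⟨t, ht⟩ =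
        if t < k₁ then 0 else 1 := by
    intro t ht
    split_ifs with h
    · exact Fin.append_left _ _ (⟨t, h⟩ : Fin k₁)
    · obtain ⟨c, rfl⟩ := Nat.exists_eq_add_of_le (not_lt.mp h)
      exact Fin.append_right _ _ (⟨c, by omega⟩ : Fin k₂)
  constructor
  · intro h
    ext1 ⟨t, ht⟩
    rw [happ, ← h t ht, extendZero_append_right u v ht]
  · rintro rfl t ht
    rw [extendZero_append_right u _ ht, happ]

lemma Fpoly_two {k₁ k₂ : ℕ} (hk₁ : 0 < k₁) (hk₂ : 0 < k₂) (n : ℕ) (p : Fin 2 → ℝ) :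
    Fpoly 2 n ![k₁, k₂] p = ∑ s : Fin n → Fin 2,
      Polynomial.C (wt 2 n p s) * Polynomial.X ^ wordCount k₁ k₂ n (extendZero s) := by
  simp only [Fpoly, patCount_two hk₁ hk₂]

theorem statement10 (k₁ k₂ : ℕ) (hk₁ : 0 < k₁) (hk₂ : 0 < k₂)
    (p₁ p₂ : ℝ) (hp₁ : 0 ≤ p₁) (hp₂ : 0 ≤ p₂) (hsum : p₁ + p₂ = 1)
    (n : ℕ) (hn : k₁ + k₂ ≤ n) :
    Fpoly 2 n ![k₁, k₂] ![p₁, p₂] =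
      Fpoly 2 (n - 1) ![k₁, k₂] ![p₁, p₂] +
        (Polynomial.X - 1) * Polynomial.C (p₁ ^ k₁ * p₂ ^ k₂) *
          Fpoly 2 (n - (k₁ + k₂)) ![k₁, k₂] ![p₁, p₂] := by
  classical
  obtain ⟨m, rfl⟩ := Nat.exists_eq_add_of_le' hn
  obtain ⟨N, hN⟩ : ∃ N, N + 1 = m + (k₁ + k₂) := ⟨m + (k₁ + k₂) - 1, by omega⟩
  rw [Nat.add_sub_cancel, show m + (k₁ + k₂) - 1 = N by omega]
  simp only [Fpoly_two hk₁ hk₂]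
  have hpow (g : ℕ → Fin 2) :
      (Polynomial.X : Polynomial ℝ) ^ wordCount k₁ k₂ (m + (k₁ + k₂)) g =
      Polynomial.X ^ wordCount k₁ k₂ N g + (Polynomial.X - 1) *
        (Polynomial.X ^ wordCount k₁ k₂ m g * if WordAt k₁ k₂ g m then 1 else 0) := by
    rw [← hN, wordCount_succ k₁ k₂ m N hN]
    split_ifs with h
    · rw [h.wordCount_eq hk₁ hk₂ hN]
      ring
    · simp
  have hlast : ∑ s : Fin (m + (k₁ + k₂)) → Fin 2, Polynomial.C (wt 2 _ ![p₁, p₂] s) *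
        Polynomial.X ^ wordCount k₁ k₂ N (extendZero s) =
      ∑ s : Fin N → Fin 2, Polynomial.C (wt 2 N ![p₁, p₂] s) *
        Polynomial.X ^ wordCount k₁ k₂ N (extendZero s) := by
    rw [← hN, sum_wt_append ![p₁, p₂] _
      (fun u => Polynomial.X ^ wordCount k₁ k₂ N (extendZero u)) (fun _ => 1)]
    · have : ∑ v : Fin 1 → Fin 2, Polynomial.C (wt 2 1 ![p₁, p₂] v) * 1 = 1 := by
        rw [← (Equiv.funUnique (Fin 1) (Fin 2)).symm.sum_comp]
        simp [wt, ← Polynomial.C_add, hsum]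
      rw [this, mul_one]
    · intro u v
      rw [mul_one, wordCount_congr fun t ht => extendZero_append_left u v ht]
  have hword : ∑ s : Fin (m + (k₁ + k₂)) → Fin 2, Polynomial.C (wt 2 _ ![p₁, p₂] s) *
        (Polynomial.X ^ wordCount k₁ k₂ m (extendZero s) *
          if WordAt k₁ k₂ (extendZero s) m then 1 else 0) =
      (∑ s : Fin m → Fin 2, Polynomial.C (wt 2 m ![p₁, p₂] s) *
        Polynomial.X ^ wordCount k₁ k₂ m (extendZero s)) * Polynomial.C (p₁ ^ k₁ * p₂ ^ k₂) := by
    rw [sum_wt_append ![p₁, p₂] _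
      (fun u => Polynomial.X ^ wordCount k₁ k₂ m (extendZero u))
      (fun v => if v = Fin.append (fun _ => 0) (fun _ => 1) then 1 else 0)]
    · congr 1
      simp only [mul_ite, mul_one, mul_zero, Finset.sum_ite_eq', Finset.mem_univ, if_true,
        wt_append]
      simp [wt]
    · intro u v
      rw [wordCount_congr fun t ht => extendZero_append_left u v ht]
      simp only [wordAt_append_iff]
  simp only [hpow, mul_add, Finset.sum_add_distrib, hlast]
  simp only [mul_left_comm _ (Polynomial.X - 1 : Polynomial ℝ), ← Finset.mul_sum, hword]
  ring
end

section
/- Let ℓ = 4, let k_1, k_2, k_3, k_4 be positive integers with k = k_1+k_2+k_3+k_4, and let p_1, p_2, p_3, p_4 ≥ 0 be reals with p_1+p_2+p_3+p_4 = 1. Then for all n ≥ k, F_{4,n}(w) = (1 + p_2 + p_3) F_{4,n−1}(w) − (p_2 + p_3 + p_2 p_3) F_{4,n−2}(w) + p_2 p_3 F_{4,n−3}(w) + (w−1) (∏_{i=1}^{4} p_i^{k_i}) F_{4,n−k}(w) as polynomials in w. -/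
open Polynomial in
/-- The sum of `f` over all words of length `n`, weighted by the product of the letter
weights.  Words are lists whose head is the last letter read. -/
noncomputable def wordSum (p : Fin 4 → ℝ) : ℕ → (List (Fin 4) → ℝ[X]) → ℝ[X]
  | 0, f => f []
  | n + 1, f => ∑ a, C (p a) * wordSum p n fun u => f (a :: u)

/-- The word starts with `r` copies of `a`, followed by a word satisfying `Q`. -/
def Run (a : Fin 4) (r : ℕ) (Q : List (Fin 4) → Prop) (l : List (Fin 4)) : Prop :=
  ∃ u, l = List.replicate r a ++ u ∧ Q u

/-- The word starts with at least `r` copies of `a`, followed by a word satisfying `Q`. -/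
def LongRun (a : Fin 4) (r : ℕ) (Q : List (Fin 4) → Prop) (l : List (Fin 4)) : Prop :=
  ∃ j, r ≤ j ∧ Run a j Q l

section Runs

variable {a b : Fin 4} {r : ℕ} {Q : List (Fin 4) → Prop} {u : List (Fin 4)}

lemma run_zero : Run a 0 Q u ↔ Q u := by simp [Run]

lemma run_succ_cons : Run a (r + 1) Q (b :: u) ↔ b = a ∧ Run a r Q u := by
  simp only [Run, List.replicate_succ, List.cons_append, List.cons.injEq]
  tauto

lemma not_run_succ_nil : ¬ Run a (r + 1) Q [] := by simp [Run, List.replicate_succ]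

lemma longRun_succ_cons :
    LongRun a (r + 1) Q (b :: u) ↔ b = a ∧ (LongRun a (r + 1) Q u ∨ Run a r Q u) := by
  constructor
  · rintro ⟨j, hj, h⟩
    obtain ⟨j, rfl⟩ : ∃ i, j = i + 1 := ⟨j - 1, by omega⟩
    rw [run_succ_cons] at h
    refine ⟨h.1, ?_⟩
    rcases (show r ≤ j by omega).eq_or_lt with rfl | hlt
    · exact Or.inr h.2
    · exact Or.inl ⟨j, hlt, h.2⟩
  · rintro ⟨rfl, ⟨j, hj, h⟩ | h⟩
    · exact ⟨j + 1, by omega, run_succ_cons.2 ⟨rfl, h⟩⟩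
    · exact ⟨r + 1, le_rfl, run_succ_cons.2 ⟨rfl, h⟩⟩

lemma run_replicate_append {s : ℕ} (h : s < r) :
    Run a r Q (List.replicate s a ++ u) ↔ Run a (r - s) Q u := by
  induction s generalizing r with
  | zero => simp
  | succ s ih =>
    obtain ⟨r, rfl⟩ : ∃ i, r = i + 1 := ⟨r - 1, by omega⟩
    rw [List.replicate_succ, List.cons_append, run_succ_cons, ih (by omega)]
    simp

lemma Run.head (hr : 0 < r) (h : Run a r Q (b :: u)) : b = a := by
  obtain ⟨r, rfl⟩ : ∃ i, r = i + 1 := ⟨r - 1, by omega⟩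
  exact (run_succ_cons.1 h).1

lemma LongRun.head (hr : 0 < r) (h : LongRun a r Q (b :: u)) : b = a := by
  obtain ⟨j, hj, h⟩ := h
  exact h.head (by omega)

lemma LongRun.not_run (hQ : ∀ v, ¬ Q (a :: v)) (h : LongRun a (r + 1) Q u) :
    ¬ Run a r Q u := by
  rintro ⟨v, rfl, hv⟩
  obtain ⟨j, hj, h⟩ := h
  rw [run_replicate_append (by omega)] at h
  obtain ⟨i, hi⟩ : ∃ i, j - r = i + 1 := ⟨j - r - 1, by omega⟩
  rw [hi] at h
  cases v with
  | nil => exact not_run_succ_nil h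
  | cons c v => exact hQ v ((run_succ_cons.1 h).1 ▸ hv)

end Runs

section WordSum

open Polynomial

variable (p : Fin 4 → ℝ)

lemma wordSum_add (n : ℕ) (f g : List (Fin 4) → ℝ[X]) :
    wordSum p n (fun u => f u + g u) = wordSum p n f + wordSum p n g := by
  induction n generalizing f g with
  | zero => rfl
  | succ n ih => simp only [wordSum, ih, mul_add, Finset.sum_add_distrib]

lemma wordSum_const_mul (n : ℕ) (c : ℝ[X]) (f : List (Fin 4) → ℝ[X]) :
    wordSum p n (fun u => c * f u) = c * wordSum p n f := by
  induction n generalizing f with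
  | zero => rfl
  | succ n ih => simp only [wordSum, ih, Finset.mul_sum, mul_left_comm]

lemma wordSum_zero (n : ℕ) : wordSum p n (fun _ => 0) = 0 := by
  simpa using wordSum_const_mul p n 0 fun _ => 0

open Classical in
lemma wordSum_succ_ite_head (n : ℕ) (a : Fin 4) (P : List (Fin 4) → Prop)
    (f : List (Fin 4) → ℝ[X]) (hP : ∀ b u, P (b :: u) → b = a) :
    wordSum p (n + 1) (fun l => if P l then f l else 0) =
      C (p a) * wordSum p n fun u => if P (a :: u) then f (a :: u) else 0 := by
  rw [wordSum, Finset.sum_eq_single a]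
  · intro b _ hb
    have (u : List (Fin 4)) : ¬ P (b :: u) := fun h => hb (hP b u h)
    simp [this, wordSum_zero]
  · simp

open Classical in
lemma wordSum_run (n r : ℕ) (a : Fin 4) (Q : List (Fin 4) → Prop)
    (f : List (Fin 4) → ℝ[X]) :
    wordSum p (n + r) (fun l => if Run a r Q l then f l else 0) =
      C (p a ^ r) * wordSum p n fun u => if Q u then f (List.replicate r a ++ u) else 0 := by
  induction r generalizing f with
  | zero => simp [run_zero]
  | succ r ih =>
    rw [← add_assoc, wordSum_succ_ite_head p _ a _ _ fun b u h => (run_succ_cons.1 h).1]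
    simp only [run_succ_cons, true_and]
    rw [ih, pow_succ', C_mul, mul_assoc]
    simp only [List.replicate_succ', List.append_assoc, List.singleton_append,
      ← List.cons_append, ← List.replicate_succ]

open Classical in
lemma wordSum_longRun (n r : ℕ) (hr : 0 < r) (a : Fin 4) (Q : List (Fin 4) → Prop)
    (hQ : ∀ v, ¬ Q (a :: v)) (f : List (Fin 4) → ℝ[X]) :
    wordSum p (n + 1) (fun l => if LongRun a r Q l then f l else 0) =
      C (p a) * wordSum p n (fun u => if LongRun a r Q u then f (a :: u) else 0) +
        wordSum p (n + 1) (fun l => if Run a r Q l then f l else 0) := by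
  obtain ⟨r, rfl⟩ : ∃ i, r = i + 1 := ⟨r - 1, by omega⟩
  rw [wordSum_succ_ite_head p _ a _ _ fun b u h => h.head hr,
    wordSum_succ_ite_head p _ a _ _ fun b u h => h.head hr, ← mul_add, ← wordSum_add]
  congr 2
  funext u
  rw [longRun_succ_cons, run_succ_cons]
  by_cases h : LongRun a (r + 1) Q u
  · simp [h, h.not_run hQ]
  · simp [h]

lemma sum_eq_wordSum (n : ℕ) (f : List (Fin 4) → ℝ[X]) :
    ∑ s : Fin n → Fin 4, C (wt 4 n p s) * f (List.ofFn s).reverse = wordSum p n f := by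
  induction n generalizing f with
  | zero => simp [wordSum, wt]
  | succ n ih =>
    rw [wordSum, ← (Fin.snocEquiv fun _ => Fin 4).sum_comp, Fintype.sum_prod_type]
    refine Finset.sum_congr rfl fun a _ => ?_
    rw [← ih, Finset.mul_sum]
    refine Finset.sum_congr rfl fun s _ => ?_
    rw [List.ofFn_succ']
    simp [wt, Fin.prod_univ_castSucc, Fin.snocEquiv, C_mul]
    ring

end WordSum

section Completion

variable (k₁ k₂ k₃ k₄ : ℕ)

/-- The last letter of the word is the one that completes an occurrence of the pattern. -/
def Completes : List (Fin 4) → Prop :=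
  Run 3 k₄ (LongRun 2 k₃ (LongRun 1 k₂ (Run 0 k₁ fun _ => True)))

open Classical in
/-- The number of times an occurrence of the pattern is completed in a word. -/
noncomputable def completions : List (Fin 4) → ℕ
  | [] => 0
  | a :: u => completions u + if Completes k₁ k₂ k₃ k₄ (a :: u) then 1 else 0

variable {k₁ k₂ k₃ k₄}

lemma completions_replicate_append (hk₄ : 0 < k₄) {a : Fin 4} (ha : a ≠ 3) (r : ℕ)
    (u : List (Fin 4)) :
    completions k₁ k₂ k₃ k₄ (List.replicate r a ++ u) = completions k₁ k₂ k₃ k₄ u := by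
  induction r with
  | zero => simp
  | succ r ih =>
    rw [List.replicate_succ, List.cons_append, completions, ih,
      if_neg, add_zero]
    exact fun h => ha (Run.head hk₄ h)

lemma completions_replicate_three_append (hk₃ : 0 < k₃) {r : ℕ} (hr : r < k₄)
    {u : List (Fin 4)} (hu : LongRun 2 k₃ (LongRun 1 k₂ (Run 0 k₁ fun _ => True)) u) :
    completions k₁ k₂ k₃ k₄ (List.replicate r 3 ++ u) = completions k₁ k₂ k₃ k₄ u := by
  induction r with
  | zero => simp
  | succ r ih =>
    rw [List.replicate_succ, List.cons_append, completions, ih (by omega), if_neg, add_zero]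
    rw [← List.cons_append, ← List.replicate_succ, Completes, run_replicate_append hr]
    obtain ⟨i, hi⟩ : ∃ i, k₄ - (r + 1) = i + 1 := ⟨k₄ - (r + 1) - 1, by omega⟩
    rw [hi]
    cases u with
    | nil => exact not_run_succ_nil
    | cons b u =>
      intro h
      have h3 := h.head (by omega)
      have h2 := hu.head hk₃
      simp [h3] at h2

end Completion

section Recurrence

open Polynomial

variable {k₁ k₂ k₃ k₄ : ℕ} (p : Fin 4 → ℝ)

open Classical in
/-- The generating polynomial of the number of completions, restricted to the words of
length `n` that satisfy `Q`. -/
noncomputable def genPoly (k₁ k₂ k₃ k₄ : ℕ) (p : Fin 4 → ℝ) (n : ℕ)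
    (Q : List (Fin 4) → Prop) : ℝ[X] :=
  wordSum p n fun u => if Q u then X ^ completions k₁ k₂ k₃ k₄ u else 0

lemma genPoly_run (hk₄ : 0 < k₄) {a : Fin 4} (ha : a ≠ 3) (n r : ℕ)
    (Q : List (Fin 4) → Prop) :
    genPoly k₁ k₂ k₃ k₄ p (n + r) (Run a r Q) =
      C (p a ^ r) * genPoly k₁ k₂ k₃ k₄ p n Q := by
  simp only [genPoly, wordSum_run, completions_replicate_append hk₄ ha]

lemma genPoly_longRun (hk₄ : 0 < k₄) {a : Fin 4} (ha : a ≠ 3) {r : ℕ} (hr : 0 < r) (n : ℕ)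
    {Q : List (Fin 4) → Prop} (hQ : ∀ v, ¬ Q (a :: v)) :
    genPoly k₁ k₂ k₃ k₄ p (n + r) (LongRun a r Q) =
      C (p a) * genPoly k₁ k₂ k₃ k₄ p (n + r - 1) (LongRun a r Q) +
        C (p a ^ r) * genPoly k₁ k₂ k₃ k₄ p n Q := by
  rw [← genPoly_run p hk₄ ha]
  obtain ⟨m, hm⟩ : ∃ m, n + r = m + 1 := ⟨n + r - 1, by omega⟩
  have hc (u : List (Fin 4)) :
      completions k₁ k₂ k₃ k₄ (a :: u) = completions k₁ k₂ k₃ k₄ u :=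
    completions_replicate_append hk₄ ha 1 u
  rw [hm, genPoly, wordSum_longRun p m r hr a Q hQ]
  simp only [hc]
  rfl

lemma genPoly_succ (hp : ∑ a, p a = 1) (hk₃ : 0 < k₃) (hk₄ : 0 < k₄) (n : ℕ) :
    genPoly k₁ k₂ k₃ k₄ p (n + k₄) (fun _ => True) =
      genPoly k₁ k₂ k₃ k₄ p (n + k₄ - 1) (fun _ => True) + (X - 1) * (C (p 3 ^ k₄) *
        genPoly k₁ k₂ k₃ k₄ p n (LongRun 2 k₃ (LongRun 1 k₂ (Run 0 k₁ fun _ => True)))) := by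
  classical
  have key : C (p 3 ^ k₄) * genPoly k₁ k₂ k₃ k₄ p n
        (LongRun 2 k₃ (LongRun 1 k₂ (Run 0 k₁ fun _ => True))) =
      wordSum p (n + k₄) fun l => if Completes k₁ k₂ k₃ k₄ l then
        X ^ completions k₁ k₂ k₃ k₄ l.tail else 0 := by
    unfold Completes
    rw [wordSum_run, genPoly]
    congr 2
    funext u
    split_ifs with hu
    · rw [List.tail_append_of_ne_nil (by simp; omega), List.tail_replicate,
        completions_replicate_three_append hk₃ (by omega) hu]
    · rfl
  rw [key]
  obtain ⟨m, hm⟩ : ∃ m, n + k₄ = m + 1 := ⟨n + k₄ - 1, by omega⟩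
  rw [hm, ← wordSum_const_mul, Nat.add_sub_cancel, genPoly, wordSum, wordSum]
  have hF : genPoly k₁ k₂ k₃ k₄ p m (fun _ => True) =
      ∑ a, C (p a) * wordSum p m fun u => X ^ completions k₁ k₂ k₃ k₄ u := by
    rw [← Finset.sum_mul, ← map_sum, hp]
    simp [genPoly]
  rw [hF, ← Finset.sum_add_distrib]
  refine Finset.sum_congr rfl fun a _ => ?_
  rw [← mul_add, ← wordSum_add]
  congr 2
  funext u
  by_cases h : Completes k₁ k₂ k₃ k₄ (a :: u)
  · simp [completions, h, pow_succ]
    ring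
  · simp [completions, h]

lemma genPoly_recurrence (hp : ∑ a, p a = 1) (hk₁ : 0 < k₁) (hk₂ : 0 < k₂) (hk₃ : 0 < k₃)
    (hk₄ : 0 < k₄) {n : ℕ} (hn : k₁ + k₂ + k₃ + k₄ ≤ n) {F : ℕ → ℝ[X]}
    (hF : ∀ m, F m = genPoly k₁ k₂ k₃ k₄ p m fun _ => True) :
    F n = C (1 + p 1 + p 2) * F (n - 1) - C (p 1 + p 2 + p 1 * p 2) * F (n - 2) +
      C (p 1 * p 2) * F (n - 3) +
      (X - 1) * C (p 0 ^ k₁ * p 1 ^ k₂ * p 2 ^ k₃ * p 3 ^ k₄) *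
        F (n - (k₁ + k₂ + k₃ + k₄)) := by
  obtain ⟨m, rfl⟩ := Nat.exists_eq_add_of_le hn
  set Q₁ : List (Fin 4) → Prop := Run 0 k₁ fun _ => True
  set Q₂ := LongRun 1 k₂ Q₁
  set Q₃ := LongRun 2 k₃ Q₂
  have hQ₁ (v) : ¬ Q₁ (1 :: v) := fun h => absurd (h.head hk₁) (by decide)
  have hQ₂ (v) : ¬ Q₂ (2 :: v) := fun h => absurd (h.head hk₂) (by decide)
  set g := genPoly k₁ k₂ k₃ k₄ p
  have step (j : ℕ) (hj : k₄ ≤ j) :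
      F j = F (j - 1) + (X - 1) * (C (p 3 ^ k₄) * g (j - k₄) Q₃) := by
    have h := genPoly_succ (k₁ := k₁) (k₂ := k₂) p hp hk₃ hk₄ (j - k₄)
    rw [Nat.sub_add_cancel hj] at h
    rw [hF, hF]
    exact h
  have step₃ (j : ℕ) (hj : k₃ ≤ j) :
      g j Q₃ = C (p 2) * g (j - 1) Q₃ + C (p 2 ^ k₃) * g (j - k₃) Q₂ := by
    have h := genPoly_longRun (k₁ := k₁) (k₂ := k₂) (k₃ := k₃) p hk₄ (a := 2) (by decide) hk₃
      (j - k₃) hQ₂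
    rwa [Nat.sub_add_cancel hj] at h
  have step₂ : g (m + k₁ + k₂) Q₂ =
      C (p 1) * g (m + k₁ + k₂ - 1) Q₂ + C (p 1 ^ k₂) * (C (p 0 ^ k₁) * F m) := by
    rw [hF, ← genPoly_run p hk₄ (by decide)]
    exact genPoly_longRun p hk₄ (by decide) hk₂ (m + k₁) hQ₁
  obtain ⟨N, hN⟩ : ∃ N, k₁ + k₂ + k₃ + k₄ + m = N + 3 :=
    ⟨k₁ + k₂ + k₃ + k₄ + m - 3, by omega⟩
  have e0 := step (N + 3) (by omega)
  have e1 := step (N + 2) (by omega)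
  have e2 := step (N + 1) (by omega)
  have d0 := step₃ (N + 3 - k₄) (by omega)
  have d1 := step₃ (N + 2 - k₄) (by omega)
  rw [show N + 3 - k₄ - 1 = N + 2 - k₄ by omega,
    show N + 3 - k₄ - k₃ = m + k₁ + k₂ by omega] at d0
  rw [show N + 2 - k₄ - 1 = N + 1 - k₄ by omega,
    show N + 2 - k₄ - k₃ = m + k₁ + k₂ - 1 by omega] at d1
  rw [hN, show N + 3 - (k₁ + k₂ + k₃ + k₄) = m by omega]
  simp only [Nat.add_sub_cancel, show N + 3 - 1 = N + 2 by omega,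
    show N + 2 - 1 = N + 1 by omega, show N + 3 - 2 = N + 1 by omega] at e0 e1 e2 ⊢
  simp only [C_add, C_mul, C_1] at *
  linear_combination e0 - (C (p 1) + C (p 2)) * e1 + C (p 1) * C (p 2) * e2 +
    (X - 1) * C (p 3 ^ k₄) * (d0 - C (p 1) * d1 + C (p 2 ^ k₃) * step₂)

end Recurrence

section Counting

/-- The list of the first `n` letters of `σ`, latest letter first. -/
def pastWord (σ : ℕ → Fin 4) : ℕ → List (Fin 4)
  | 0 => []
  | n + 1 => σ n :: pastWord σ n

lemma pastWord_eq_reverse_ofFn (σ : ℕ → Fin 4) (n : ℕ) :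
    pastWord σ n = (List.ofFn fun i : Fin n => σ i).reverse := by
  induction n with
  | zero => rfl
  | succ n ih =>
    rw [List.ofFn_succ']
    simp [pastWord, ih]

lemma run_pastWord {σ : ℕ → Fin 4} {n r : ℕ} {a : Fin 4} {Q : List (Fin 4) → Prop} :
    Run a r Q (pastWord σ n) ↔
      ∃ i, i + r = n ∧ (∀ t, i ≤ t → t < n → σ t = a) ∧ Q (pastWord σ i) := by
  induction n generalizing r with
  | zero =>
    cases r with
    | zero => simp [run_zero]
    | succ r => simp [pastWord, not_run_succ_nil]
  | succ n ih =>
    cases r with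
    | zero =>
      simp only [run_zero, add_zero, exists_eq_left]
      exact ⟨fun h => ⟨fun t _ _ => by omega, h⟩, fun h => h.2⟩
    | succ r =>
      rw [pastWord, run_succ_cons, ih]
      constructor
      · rintro ⟨h0, i, hi, hb, hQ⟩
        refine ⟨i, by omega, fun t h1 h2 => ?_, hQ⟩
        rcases (show t ≤ n by omega).eq_or_lt with rfl | h
        · exact h0
        · exact hb t h1 h
      · rintro ⟨i, hi, hb, hQ⟩
        exact ⟨hb n (by omega) (by omega), i, by omega,
          fun t h1 h2 => hb t h1 (by omega), hQ⟩

lemma longRun_pastWord {σ : ℕ → Fin 4} {n r : ℕ} {a : Fin 4} {Q : List (Fin 4) → Prop} :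
    LongRun a r Q (pastWord σ n) ↔
      ∃ i, i + r ≤ n ∧ (∀ t, i ≤ t → t < n → σ t = a) ∧ Q (pastWord σ i) := by
  simp only [LongRun, run_pastWord]
  constructor
  · rintro ⟨j, hj, i, hi, h⟩
    exact ⟨i, by omega, h⟩
  · rintro ⟨i, hi, h⟩
    exact ⟨n - i, by omega, i, by omega, h⟩

/-- In `σ` there is an occurrence of the pattern whose blocks start at `i₀`, `i₁`, `i₂`
and `i₃`. -/
structure BlocksAt (k₁ k₂ k₃ k₄ : ℕ) (σ : ℕ → Fin 4) (i₀ i₁ i₂ i₃ : ℕ) : Prop where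
  le₁ : i₀ + k₁ ≤ i₁
  le₂ : i₁ + k₂ ≤ i₂
  le₃ : i₂ + k₃ ≤ i₃
  eq₀ : ∀ t, i₀ ≤ t → t < i₁ → σ t = 0
  eq₁ : ∀ t, i₁ ≤ t → t < i₂ → σ t = 1
  eq₂ : ∀ t, i₂ ≤ t → t < i₃ → σ t = 2
  eq₃ : ∀ t, i₃ ≤ t → t < i₃ + k₄ → σ t = 3
  start : i₀ = 0 ∨ σ (i₀ - 1) ≠ 0

variable {k₁ k₂ k₃ k₄ : ℕ} {σ : ℕ → Fin 4}

lemma le_of_blocks {a b : Fin 4} (hab : a ≠ b) {i x y z : ℕ} (hxz : x < z) (hix : i ≤ x)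
    (ha : ∀ t, i ≤ t → t < y → σ t = a) (hb : ∀ t, x ≤ t → t < z → σ t = b) : y ≤ x := by
  by_contra! h
  exact hab ((ha x hix h).symm.trans (hb x le_rfl hxz))

lemma le_of_blocks_left {a b : Fin 4} (hab : a ≠ b) {i x y z : ℕ} (hix : i < x) (hxz : x ≤ z)
    (ha : ∀ t, i ≤ t → t < x → σ t = a) (hb : ∀ t, y ≤ t → t < z → σ t = b) : x ≤ y := by
  by_contra! h
  exact hab ((ha (x - 1) (by omega) (by omega)).symm.trans
    (hb (x - 1) (by omega) (by omega)))

lemma BlocksAt.last_unique (hk₁ : 0 < k₁) (hk₂ : 0 < k₂) (hk₃ : 0 < k₃) (hk₄ : 0 < k₄)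
    {i i₁ i₂ i₃ j₁ j₂ j₃ : ℕ} (h : BlocksAt k₁ k₂ k₃ k₄ σ i i₁ i₂ i₃)
    (h' : BlocksAt k₁ k₂ k₃ k₄ σ i j₁ j₂ j₃) : i₃ = j₃ := by
  obtain ⟨a1, a2, a3, b0, b1, b2, b3, -⟩ := h
  obtain ⟨c1, c2, c3, d0, d1, d2, d3, -⟩ := h'
  obtain rfl : i₁ = j₁ := le_antisymm
    (le_of_blocks (by decide) (by omega) (by omega) b0 d1)
    (le_of_blocks (by decide) (by omega) (by omega) d0 b1)
  obtain rfl : i₂ = j₂ := le_antisymm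
    (le_of_blocks (by decide) (by omega) (by omega) b1 d2)
    (le_of_blocks (by decide) (by omega) (by omega) d1 b2)
  exact le_antisymm
    (le_of_blocks (by decide) (by omega) (by omega) b2 d3)
    (le_of_blocks (by decide) (by omega) (by omega) d2 b3)

lemma BlocksAt.first_unique (hk₁ : 0 < k₁) (hk₂ : 0 < k₂) (hk₃ : 0 < k₃)
    {i₀ i₁ i₂ i j₀ j₁ j₂ : ℕ} (h : BlocksAt k₁ k₂ k₃ k₄ σ i₀ i₁ i₂ i)
    (h' : BlocksAt k₁ k₂ k₃ k₄ σ j₀ j₁ j₂ i) : i₀ = j₀ := by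
  obtain ⟨a1, a2, a3, b0, b1, b2, b3, b⟩ := h
  obtain ⟨c1, c2, c3, d0, d1, d2, d3, d⟩ := h'
  obtain rfl : i₂ = j₂ := le_antisymm
    (le_of_blocks_left (by decide) (by omega) (by omega) b1 d2)
    (le_of_blocks_left (by decide) (by omega) (by omega) d1 b2)
  obtain rfl : i₁ = j₁ := le_antisymm
    (le_of_blocks_left (by decide) (by omega) (by omega) b0 d1)
    (le_of_blocks_left (by decide) (by omega) (by omega) d0 b1)
  rcases lt_trichotomy i₀ j₀ with hlt | heq | hlt
  · exact absurd (b0 (j₀ - 1) (by omega) (by omega)) (d.resolve_left (by omega))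
  · exact heq
  · exact absurd (d0 (i₀ - 1) (by omega) (by omega)) (b.resolve_left (by omega))

lemma exists_run_start {σ : ℕ → Fin 4} {a : Fin 4} {i m : ℕ}
    (h : ∀ t, i ≤ t → t < m → σ t = a) :
    ∃ j ≤ i, (∀ t, j ≤ t → t < m → σ t = a) ∧ (j = 0 ∨ σ (j - 1) ≠ a) := by
  induction i with
  | zero => exact ⟨0, le_rfl, h, Or.inl rfl⟩
  | succ i ih =>
    by_cases hi : σ i = a
    · obtain ⟨j, hj, h'⟩ := ih fun t h1 h2 => by
        rcases h1.eq_or_lt with rfl | h1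
        · exact hi
        · exact h t h1 h2
      exact ⟨j, by omega, h'⟩
    · exact ⟨i + 1, le_rfl, h, Or.inr hi⟩

lemma completes_pastWord (n : ℕ) :
    Completes k₁ k₂ k₃ k₄ (pastWord σ n) ↔
      ∃ i₀ i₁ i₂ i₃, BlocksAt k₁ k₂ k₃ k₄ σ i₀ i₁ i₂ i₃ ∧ i₃ + k₄ = n := by
  simp only [Completes, run_pastWord, longRun_pastWord]
  constructor
  · rintro ⟨i₃, rfl, e3, i₂, h3, e2, i₁, h2, e1, i₀, h1, e0, -⟩
    obtain ⟨j, hj, e0, hs⟩ := exists_run_start e0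
    exact ⟨j, i₁, i₂, i₃, ⟨by omega, h2, h3, e0, e1, e2, e3, hs⟩, rfl⟩
  · rintro ⟨i₀, i₁, i₂, i₃, ⟨h1, h2, h3, e0, e1, e2, e3, -⟩, rfl⟩
    exact ⟨i₃, rfl, e3, i₂, h3, e2, i₁, h2, e1, i₁ - k₁, by omega,
      fun t _ _ => e0 t (by omega) (by omega), trivial⟩

lemma occursAt_iff (hk₁ : 0 < k₁) (n j : ℕ) :
    OccursAt 4 n ![k₁, k₂, k₃, k₄] (fun i => σ i) j ↔
      ∃ i₁ i₂ i₃, BlocksAt k₁ k₂ k₃ k₄ σ j i₁ i₂ i₃ ∧ i₃ + k₄ ≤ n := by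
  constructor
  · rintro ⟨f, rfl, hn, hle, heq, hs⟩
    have l0 := hle 0
    have l1 := hle 1
    have l2 := hle 2
    have l3 := hle 3
    simp at l0 l1 l2 l3
    refine ⟨f 1, f 2, f 3, ⟨l0, l1, l2, fun t h1 h2 => ?_, fun t h1 h2 => ?_,
      fun t h1 h2 => ?_, fun t h1 h2 => ?_, ?_⟩, by omega⟩
    · exact Fin.ext (heq 0 t (by omega) h1 h2)
    · exact Fin.ext (heq 1 t (by omega) h1 h2)
    · exact Fin.ext (heq 2 t (by omega) h1 h2)
    · exact Fin.ext (heq 3 t (by omega) h1 (show t < f 4 by omega))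
    · rcases hs with hs | ⟨h, hs⟩
      · exact Or.inl hs
      · exact Or.inr fun h0 => hs (by simp [h0])
  · rintro ⟨i₁, i₂, i₃, ⟨h1, h2, h3, e0, e1, e2, e3, hs⟩, hn⟩
    refine ⟨fun t => match t with
      | 0 => j | 1 => i₁ | 2 => i₂ | 3 => i₃ | _ => i₃ + k₄, rfl, hn, ?_, ?_, ?_⟩
    · intro i
      fin_cases i
      exacts [h1, h2, h3, le_rfl]
    · intro i t ht ha hb
      fin_cases i
      · exact congrArg Fin.val (e0 t ha hb)
      · exact congrArg Fin.val (e1 t ha hb)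
      · exact congrArg Fin.val (e2 t ha hb)
      · exact congrArg Fin.val (e3 t ha hb)
    · exact hs.imp_right fun hs => ⟨by omega, fun h => hs (Fin.ext h)⟩

lemma patCount_eq_completions (hk₁ : 0 < k₁) (hk₂ : 0 < k₂) (hk₃ : 0 < k₃) (hk₄ : 0 < k₄)
    (n : ℕ) :
    patCount 4 n ![k₁, k₂, k₃, k₄] (fun i => σ i) =
      completions k₁ k₂ k₃ k₄ (pastWord σ n) := by
  simp only [patCount, occursAt_iff hk₁]
  induction n with
  | zero =>
    rw [pastWord, completions]
    convert Set.ncard_empty ℕ using 2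
    ext j
    simp
    omega
  | succ n ih =>
    set A := {j | ∃ i₁ i₂ i₃, BlocksAt k₁ k₂ k₃ k₄ σ j i₁ i₂ i₃ ∧ i₃ + k₄ ≤ n} with hA
    have hfin : A.Finite := (Set.finite_Iic n).subset <| by
      rintro j ⟨i₁, i₂, i₃, h, hn⟩
      have := h.le₁
      have := h.le₂
      have := h.le₃
      exact Set.mem_Iic.2 (by omega)
    rw [pastWord, completions, ← ih, ← pastWord]
    split_ifs with hc
    · obtain ⟨i₀, i₁, i₂, i₃, h, hn⟩ := (completes_pastWord _).1 hc
      have hnot : i₀ ∉ A := by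
        rintro ⟨j₁, j₂, j₃, h', hn'⟩
        have := h.last_unique hk₁ hk₂ hk₃ hk₄ h'
        omega
      rw [← Set.ncard_insert_of_notMem hnot hfin]
      congr 1
      ext j
      constructor
      · rintro ⟨j₁, j₂, j₃, h', hn'⟩
        rcases hn'.lt_or_eq with hlt | heq
        · exact Or.inr ⟨j₁, j₂, j₃, h', by omega⟩
        · obtain rfl : j₃ = i₃ := by omega
          exact Or.inl (h'.first_unique hk₁ hk₂ hk₃ h)
      · rintro (rfl | ⟨j₁, j₂, j₃, h', hn'⟩)
        · exact ⟨i₁, i₂, i₃, h, hn.le⟩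
        · exact ⟨j₁, j₂, j₃, h', by omega⟩
    · rw [add_zero]
      congr 1
      ext j
      constructor
      · rintro ⟨j₁, j₂, j₃, h', hn'⟩
        refine ⟨j₁, j₂, j₃, h', ?_⟩
        by_contra hlt
        exact hc ((completes_pastWord _).2 ⟨j, j₁, j₂, j₃, h', by omega⟩)
      · rintro ⟨j₁, j₂, j₃, h', hn'⟩
        exact ⟨j₁, j₂, j₃, h', by omega⟩

lemma Fpoly_eq_genPoly (hk₁ : 0 < k₁) (hk₂ : 0 < k₂) (hk₃ : 0 < k₃) (hk₄ : 0 < k₄)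
    (p : Fin 4 → ℝ) (n : ℕ) :
    Fpoly 4 n ![k₁, k₂, k₃, k₄] p = genPoly k₁ k₂ k₃ k₄ p n fun _ => True := by
  simp only [Fpoly, genPoly, if_true, ← sum_eq_wordSum]
  refine Finset.sum_congr rfl fun s _ => ?_
  obtain ⟨σ, rfl⟩ : ∃ σ : ℕ → Fin 4, s = fun i : Fin n => σ i :=
    ⟨fun t => if h : t < n then s ⟨t, h⟩ else 0, by ext i; simp⟩
  rw [patCount_eq_completions hk₁ hk₂ hk₃ hk₄, pastWord_eq_reverse_ofFn]

end Counting

theorem statement12 (k₁ k₂ k₃ k₄ : ℕ)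
    (hk₁ : 0 < k₁) (hk₂ : 0 < k₂) (hk₃ : 0 < k₃) (hk₄ : 0 < k₄)
    (p₁ p₂ p₃ p₄ : ℝ) (hp₁ : 0 ≤ p₁) (hp₂ : 0 ≤ p₂) (hp₃ : 0 ≤ p₃) (hp₄ : 0 ≤ p₄)
    (hsum : p₁ + p₂ + p₃ + p₄ = 1)
    (n : ℕ) (hn : k₁ + k₂ + k₃ + k₄ ≤ n) :
    Fpoly 4 n ![k₁, k₂, k₃, k₄] ![p₁, p₂, p₃, p₄] =
      Polynomial.C (1 + p₂ + p₃) * Fpoly 4 (n - 1) ![k₁, k₂, k₃, k₄] ![p₁, p₂, p₃, p₄] -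
        Polynomial.C (p₂ + p₃ + p₂ * p₃) *
          Fpoly 4 (n - 2) ![k₁, k₂, k₃, k₄] ![p₁, p₂, p₃, p₄] +
        Polynomial.C (p₂ * p₃) * Fpoly 4 (n - 3) ![k₁, k₂, k₃, k₄] ![p₁, p₂, p₃, p₄] +
        (Polynomial.X - 1) * Polynomial.C (p₁ ^ k₁ * p₂ ^ k₂ * p₃ ^ k₃ * p₄ ^ k₄) *
          Fpoly 4 (n - (k₁ + k₂ + k₃ + k₄)) ![k₁, k₂, k₃, k₄] ![p₁, p₂, p₃, p₄] := by
  have hp : ∑ a, ![p₁, p₂, p₃, p₄] a = 1 := by simpa [Fin.sum_univ_four] using hsum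
  simpa using genPoly_recurrence _ hp hk₁ hk₂ hk₃ hk₄ hn
    (Fpoly_eq_genPoly hk₁ hk₂ hk₃ hk₄ ![p₁, p₂, p₃, p₄])
end
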